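/- arXiv:2511.18540 — 4 statements merged into one kernel-verified Lean document; each statement's English description precedes it below -/
import Mathlib

section
/- Let L = E[C_1, …, C_n] be a congruence normal lattice, obtained from the one-element lattice by successively doubling the nonempty convex subsets C_1, …, C_n. If L is shellable, then for every i ∈ {1, …, n}, the subset C_i intersects the spine of E[C_1, …, C_{i−1}]. -/
universe u

/-- The length of a finite poset: the maximum `n` such that there is a chain
`x_0 < x_1 < ⋯ < x_n`. -/
noncomputable def latLen (β : Type u) [Preorder β] : ℕ :=
  sSup {n : ℕ | ∃ f : Fin (n + 1) → β, StrictMono f}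

/-- The spine of a finite poset: the set of elements lying on some chain of
maximum length. -/
noncomputable def spine (β : Type u) [Preorder β] : Set β :=
  {a : β | ∃ f : Fin (latLen β + 1) → β, StrictMono f ∧ a ∈ Set.range f}

/-- The order ideal `I_L(C)` generated by a subset `C`. -/
def lowerIdeal {α : Type u} [Preorder α] (C : Set α) : Set α :=
  {y : α | ∃ x ∈ C, y ≤ x}

/-- The underlying subset of `L × {0,1}` of Day's doubling `L[C]`:
`(I_L(C) × {0}) ∪ (((L \ I_L(C)) ∪ C) × {1})`. -/
def doublingSet {α : Type u} [Preorder α] (C : Set α) : Set (α × Bool) :=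
  {p : α × Bool | (p.2 = false ∧ p.1 ∈ lowerIdeal C) ∨
    (p.2 = true ∧ (p.1 ∉ lowerIdeal C ∨ p.1 ∈ C))}

/-- Day's doubling `L[C]`, as a subposet of the product `L × {0,1}` where `0 < 1`. -/
abbrev Doubling {α : Type u} [Preorder α] (C : Set α) : Type u :=
  {p : α × Bool // p ∈ doublingSet C}

open Classical in
/-- A finite lattice is shellable if there is an enumeration `F 0, …, F (k-1)` of all its
maximal chains (as finite sets) such that for all `i < j` there is `l < j` with
`F i ∩ F j ⊆ F l ∩ F j` and `|F l ∩ F j| = |F j| - 1`. -/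
def IsShellable (β : Type u) [Lattice β] : Prop :=
  ∃ (k : ℕ) (F : Fin k → Finset β),
    Function.Injective F ∧
    (∀ s : Set β, IsMaxChain (· ≤ ·) s ↔ ∃ i : Fin k, (↑(F i) : Set β) = s) ∧
    (∀ i j : Fin k, i < j → ∃ l : Fin k, l < j ∧
      F i ∩ F j ⊆ F l ∩ F j ∧ (F l ∩ F j).card = (F j).card - 1)

/-- The projection from a lattice isomorphic to the doubling `α[C]` onto `α`, which is a lattice
homomorphism because `C` is convex. -/
def doublingProj {α β : Type u} [Lattice α] [Lattice β] {C : Set α} (hC : C.OrdConnected)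
    (e : β ≃o Doubling C) : LatticeHom β α where
  toFun x := (e x).1.1
  map_sup' x y := by
    have hmono : ∀ {s t : β}, s ≤ t → (e s).1.1 ≤ (e t).1.1 := fun h => (e.monotone h).1
    refine le_antisymm ?_ (sup_le (hmono le_sup_left) (hmono le_sup_right))
    obtain ⟨d, hd, hx, hy⟩ : ∃ d : Doubling C,
        d.1.1 = (e x).1.1 ⊔ (e y).1.1 ∧ e x ≤ d ∧ e y ≤ d := by
      by_cases h : (e x).1.1 ⊔ (e y).1.1 ∈ lowerIdeal C ∧ (e x).1.1 ⊔ (e y).1.1 ∉ C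
      · have key : ∀ w : Doubling C, w.1.1 ≤ (e x).1.1 ⊔ (e y).1.1 → w.1.2 = false := by
          intro w hw
          obtain ⟨⟨c, hc, hle⟩, hn⟩ := h
          rcases w.2 with h | ⟨-, h | h⟩
          · exact h.1
          · exact absurd ⟨c, hc, hw.trans hle⟩ h
          · exact absurd (hC.out h hc ⟨hw, hle⟩) hn
        exact ⟨⟨(_, false), Or.inl ⟨rfl, h.1⟩⟩, rfl,
          ⟨le_sup_left, (key _ le_sup_left).le⟩, ⟨le_sup_right, (key _ le_sup_right).le⟩⟩
      · exact ⟨⟨(_, true), Or.inr ⟨rfl, by tauto⟩⟩, rfl,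
          ⟨le_sup_left, Bool.le_true _⟩, ⟨le_sup_right, Bool.le_true _⟩⟩
    rw [← hd]
    have h : e (x ⊔ y) ≤ d :=
      e.le_symm_apply.1 (sup_le (e.le_symm_apply.2 hx) (e.le_symm_apply.2 hy))
    exact h.1
  map_inf' x y := by
    have hmono : ∀ {s t : β}, s ≤ t → (e s).1.1 ≤ (e t).1.1 := fun h => (e.monotone h).1
    refine le_antisymm (le_inf (hmono inf_le_left) (hmono inf_le_right)) ?_
    obtain ⟨d, hd, hx, hy⟩ : ∃ d : Doubling C,
        d.1.1 = (e x).1.1 ⊓ (e y).1.1 ∧ d ≤ e x ∧ d ≤ e y := by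
      by_cases h : (e x).1.1 ⊓ (e y).1.1 ∈ lowerIdeal C
      · exact ⟨⟨(_, false), Or.inl ⟨rfl, h⟩⟩, rfl,
          ⟨inf_le_left, Bool.false_le _⟩, ⟨inf_le_right, Bool.false_le _⟩⟩
      · have key : ∀ w : Doubling C, (e x).1.1 ⊓ (e y).1.1 ≤ w.1.1 → w.1.2 = true := by
          intro w hw
          rcases w.2 with ⟨-, c, hc, hle⟩ | h'
          · exact absurd ⟨c, hc, hw.trans hle⟩ h
          · exact h'.1
        exact ⟨⟨(_, true), Or.inr ⟨rfl, Or.inl h⟩⟩, rfl,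
          ⟨inf_le_left, (key _ inf_le_left).ge⟩, ⟨inf_le_right, (key _ inf_le_right).ge⟩⟩
    rw [← hd]
    have h : d ≤ e (x ⊓ y) :=
      e.symm_apply_le.1 (le_inf (e.symm_apply_le.2 hx) (e.symm_apply_le.2 hy))
    exact h.1

theorem doublingProj_apply {α β : Type u} [Lattice α] [Lattice β] {C : Set α}
    (hC : C.OrdConnected) (e : β ≃o Doubling C) (x : β) :
    doublingProj hC e x = (e x).1.1 := rfl

theorem doublingProj_surjective {α β : Type u} [Lattice α] [Lattice β] {C : Set α}
    (hC : C.OrdConnected) (e : β ≃o Doubling C) : Function.Surjective (doublingProj hC e) := by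
  intro a
  by_cases h : a ∈ lowerIdeal C
  · exact ⟨e.symm ⟨(a, false), Or.inl ⟨rfl, h⟩⟩, by simp [doublingProj_apply]⟩
  · exact ⟨e.symm ⟨(a, true), Or.inr ⟨rfl, Or.inl h⟩⟩, by simp [doublingProj_apply]⟩

/-- The image of `s` under `g` contains both copies of some doubled element. -/
def MeetsBothCopies {α L : Type u} [Preorder α] {C : Set α} (g : L → Doubling C)
    (s : Set L) : Prop :=
  ∃ x ∈ s, ∃ y ∈ s, (g x).1.1 = (g y).1.1 ∧ (g x).1.2 = false ∧ (g y).1.2 = true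

/-- If a maximal chain `t` contains all elements of the maximal chain `s` except `m`, then `t`
passes through both copies of a doubled element whenever `s` does. -/
theorem MeetsBothCopies.exchange {α β L : Type u} [Lattice α] [Lattice β] [Lattice L] {C : Set α}
    (hC : C.OrdConnected) (e : β ≃o Doubling C) (f : LatticeHom L β) {s t : Set L}
    (hs : IsMaxChain (· ≤ ·) s) (ht : IsMaxChain (· ≤ ·) t) {m : L} (hms : m ∈ s) (hmt : m ∉ t)
    (hst : ∀ w ∈ s, w ≠ m → w ∈ t) (h : MeetsBothCopies (fun x => e (f x)) s) :
    MeetsBothCopies (fun x => e (f x)) t := by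
  obtain ⟨z, hzt, hzm, hmz⟩ : ∃ z ∈ t, ¬ z ≤ m ∧ ¬ m ≤ z := by
    by_contra! hcon
    have hins : IsChain (· ≤ ·) (insert m t) := ht.1.insert fun b hb _ => by
      by_cases hbm : b ≤ m
      · exact Or.inr hbm
      · exact Or.inl (hcon b hb hbm)
    exact hmt (ht.2 hins (Set.subset_insert m t) ▸ Set.mem_insert m t)
  have hbelow : ∀ w ∈ s, w ≤ m → w ≠ m → w ≤ z ⊓ m := fun w hw hwm hne =>
    le_inf ((ht.1.total (hst w hw hne) hzt).resolve_right fun h => hzm (h.trans hwm)) hwm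
  have habove : ∀ w ∈ s, m ≤ w → w ≠ m → z ⊔ m ≤ w := fun w hw hmw hne =>
    sup_le ((ht.1.total (hst w hw hne) hzt).resolve_left fun h => hmz (hmw.trans h)) hmw
  have hpt : z ⊓ m ∈ t := by
    refine hst _ ?_ fun h => hmz (inf_eq_right.1 h)
    have hins : IsChain (· ≤ ·) (insert (z ⊓ m) s) := hs.1.insert fun b hb _ => by
      rcases eq_or_ne b m with rfl | hbm
      · exact Or.inl inf_le_right
      · exact (hs.1.total hb hms).elim
          (fun h => Or.inr (hbelow b hb h hbm)) (fun h => Or.inl (inf_le_right.trans h))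
    exact hs.2 hins (Set.subset_insert _ s) ▸ Set.mem_insert _ s
  have hyt : z ⊔ m ∈ t := by
    refine hst _ ?_ fun h => hzm (sup_eq_right.1 h)
    have hins : IsChain (· ≤ ·) (insert (z ⊔ m) s) := hs.1.insert fun b hb _ => by
      rcases eq_or_ne b m with rfl | hbm
      · exact Or.inr le_sup_right
      · exact (hs.1.total hb hms).elim
          (fun h => Or.inr (h.trans le_sup_right)) (fun h => Or.inl (habove b hb h hbm))
    exact hs.2 hins (Set.subset_insert _ s) ▸ Set.mem_insert _ s
  have hmono : ∀ {a b : L}, a ≤ b → e (f a) ≤ e (f b) := fun h =>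
    e.monotone (OrderHomClass.mono f h)
  have hle : ∀ {a b : L}, (e (f a)).1.1 ≤ (e (f b)).1.1 → (e (f a)).1.2 ≤ (e (f b)).1.2 →
      f a ≤ f b := fun h₁ h₂ => e.le_iff_le.1 ⟨h₁, h₂⟩
  have hinf : (e (f (z ⊓ m))).1.1 = (e (f z)).1.1 ⊓ (e (f m)).1.1 := by
    rw [map_inf]; exact map_inf (doublingProj hC e) _ _
  have hsup : (e (f (z ⊔ m))).1.1 = (e (f z)).1.1 ⊔ (e (f m)).1.1 := by
    rw [map_sup]; exact map_sup (doublingProj hC e) _ _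
  obtain ⟨u, hu, v, hv, huv, hu0, hv1⟩ := h
  dsimp only at huv hu0 hv1
  have hne : u ≠ v := by
    rintro rfl
    simp [hu0] at hv1
  have hle_uv : u ≤ v := (hs.1.total hu hv).resolve_right fun h => by
    have h' := (hmono h).2
    rw [hu0, hv1] at h'
    exact absurd h' (by decide)
  by_cases hum : u = m
  · subst hum
    have hvt := hst v hv hne.symm
    have hyv : z ⊔ u ≤ v := habove v hv hle_uv hne.symm
    have hy : (e (f (z ⊔ u))).1.1 = (e (f u)).1.1 :=
      le_antisymm (huv ▸ (hmono hyv).1) (hmono le_sup_right).1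
    cases hr : (e (f (z ⊔ u))).1.2 with
    | false => exact ⟨_, hyt, v, hvt, hy.trans huv, hr, hv1⟩
    | true =>
      have hzu : (e (f z)).1.1 ≤ (e (f u)).1.1 := hy ▸ (hmono le_sup_left).1
      refine ⟨_, hpt, z, hzt, hinf.trans (inf_eq_left.2 hzu), ?_, ?_⟩
      · exact Bool.eq_false_of_le_false (hu0 ▸ (hmono inf_le_right).2)
      · by_contra hz
        rw [Bool.not_eq_true] at hz
        have h := hle hzu (hz.trans hu0.symm).le
        rw [map_sup, sup_eq_right.2 h, hu0] at hr
        exact absurd hr (by decide)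
  · have hut := hst u hu hum
    by_cases hvm : v = m
    · subst hvm
      have hup : u ≤ z ⊓ v := hbelow u hu hle_uv hne
      have hp : (e (f (z ⊓ v))).1.1 = (e (f v)).1.1 :=
        le_antisymm (hmono inf_le_right).1 (huv ▸ (hmono hup).1)
      cases hr : (e (f (z ⊓ v))).1.2 with
      | true => exact ⟨u, hut, _, hpt, huv.trans hp.symm, hu0, hr⟩
      | false =>
        have hvz : (e (f v)).1.1 ≤ (e (f z)).1.1 := hp ▸ (hmono inf_le_left).1
        refine ⟨z, hzt, _, hyt, (hsup.trans (sup_eq_left.2 hvz)).symm, ?_, ?_⟩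
        · by_contra hz
          rw [Bool.not_eq_false] at hz
          have h := hle hvz (hv1.trans hz.symm).le
          rw [map_inf, inf_eq_right.2 h, hv1] at hr
          exact absurd hr (by decide)
        · exact Bool.eq_true_of_true_le (hv1 ▸ (hmono le_sup_right).2)
    · exact ⟨u, hut, v, hst v hv hvm, huv, hu0, hv1⟩

/-- A shellable lattice has a single maximal chain that passes through both copies of a doubled
element in every doubling quotient for which some maximal chain does. -/
theorem IsShellable.exists_isMaxChain {L : Type u} [Lattice L] (hL : IsShellable L) :
    ∃ s : Finset L, IsMaxChain (· ≤ ·) (s : Set L) ∧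
      ∀ {α β : Type u} [Lattice α] [Lattice β] {C : Set α}, C.OrdConnected →
        ∀ (e : β ≃o Doubling C) (f : LatticeHom L β) {t : Set L}, IsMaxChain (· ≤ ·) t →
          MeetsBothCopies (fun x => e (f x)) t →
          MeetsBothCopies (fun x => e (f x)) (s : Set L) := by
  classical
  obtain ⟨k, F, -, hmax, hF⟩ := hL
  have hchain : ∀ i, IsMaxChain (· ≤ ·) (F i : Set L) := fun i => (hmax _).2 ⟨i, rfl⟩
  obtain ⟨j₀, -⟩ := (hmax _).1 (maxChain_spec (α := L) (r := (· ≤ ·)))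
  have hk : 0 < k := j₀.pos
  refine ⟨F ⟨0, hk⟩, hchain _, ?_⟩
  intro α β _ _ C hC e f t ht htC
  obtain ⟨j, rfl⟩ := (hmax t).1 ht
  clear ht
  induction j using WellFoundedLT.induction with
  | ind j ih =>
    by_cases hj : j = ⟨0, hk⟩
    · exact hj ▸ htC
    have hlt : (⟨0, hk⟩ : Fin k) < j := by
      rw [Fin.lt_def]
      exact Nat.pos_of_ne_zero fun h => hj (Fin.ext h)
    obtain ⟨l, hl, -, hcard⟩ := hF _ j hlt
    have hpos : 0 < (F j).card := by
      obtain ⟨x, hx, -⟩ := htC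
      exact Finset.card_pos.2 ⟨x, hx⟩
    have hone : (F j \ F l).card = 1 := by
      have := Finset.card_sdiff_add_card_inter (F j) (F l)
      rw [Finset.inter_comm] at this
      omega
    obtain ⟨m, hm⟩ := Finset.card_eq_one.1 hone
    have hmem : ∀ w, w ∈ F j ∧ w ∉ F l ↔ w = m := fun w => by
      rw [← Finset.mem_sdiff, hm, Finset.mem_singleton]
    obtain ⟨hmj, hml⟩ := (hmem m).2 rfl
    refine ih l hl (htC.exchange hC e f (hchain j) (hchain l) hmj hml fun w hw hwm => ?_)
    by_contra hwl
    exact hwm ((hmem w).1 ⟨hw, hwl⟩)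

/-- Some maximal chain passes through both copies of a doubled element. -/
theorem exists_isMaxChain_meetsBothCopies {α β L : Type u} [Lattice α] [Lattice β] [Lattice L]
    {C : Set α} (hne : C.Nonempty) (e : β ≃o Doubling C) (f : LatticeHom L β)
    (hf : Function.Surjective f) :
    ∃ t : Set L, IsMaxChain (· ≤ ·) t ∧ MeetsBothCopies (fun x => e (f x)) t := by
  obtain ⟨a, ha⟩ := hne
  let d₀ : Doubling C := ⟨(a, false), Or.inl ⟨rfl, a, ha, le_rfl⟩⟩
  let d₁ : Doubling C := ⟨(a, true), Or.inr ⟨rfl, Or.inr ha⟩⟩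
  have hd : e.symm d₀ ≤ e.symm d₁ := e.symm.monotone ⟨le_rfl, Bool.false_le _⟩
  obtain ⟨x, hx⟩ := hf (e.symm d₀)
  obtain ⟨y, hy⟩ := hf (e.symm d₁)
  have hy' : f (x ⊔ y) = e.symm d₁ := by rw [map_sup, hx, hy, sup_eq_right.2 hd]
  have hc : IsChain (· ≤ ·) ({x, x ⊔ y} : Set L) := IsChain.pair le_sup_left
  obtain ⟨t, ht, hsub⟩ := IsChain.exists_maxChain hc
  refine ⟨t, ht, x, hsub (by simp), x ⊔ y, hsub (by simp), ?_⟩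
  simp [hx, hy', d₀, d₁]

theorem IsChain.card_le_card_image_doublingProj_add_one {α β : Type u} [Lattice α] [Lattice β]
    [DecidableEq α] {C : Set α} (hC : C.OrdConnected) (e : β ≃o Doubling C) {s : Finset β}
    (hs : IsChain (· ≤ ·) (s : Set β)) : s.card ≤ (s.image (doublingProj hC e)).card + 1 := by
  classical
  have hcross : ∀ x ∈ s, ∀ y ∈ s, (e x).1.2 = false → (e y).1.2 = true → e x ≤ e y := by
    intro x hx y hy hx0 hy1
    refine e.monotone ((hs.total hx hy).resolve_right fun h => ?_)
    have h' := (e.monotone h).2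
    rw [hx0, hy1] at h'
    exact absurd h' (by decide)
  have hext : ∀ x y : β, (e x).1.1 = (e y).1.1 → (e x).1.2 = (e y).1.2 → x = y :=
    fun x y h₁ h₂ => e.injective (Subtype.ext (Prod.ext h₁ h₂))
  by_cases hinj : ∃ x ∈ s, ∃ y ∈ s, (e x).1.1 = (e y).1.1 ∧ (e x).1.2 = false ∧ (e y).1.2 = true
  · obtain ⟨x, hx, y, hy, hxy, hx0, hy1⟩ := hinj
    have hunique : ∀ u ∈ s, ∀ v ∈ s, (e u).1.1 = (e v).1.1 → (e u).1.2 = false →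
        (e v).1.2 = true → v = y := fun u hu v hv huv hu0 hv1 =>
      hext v y (le_antisymm (huv ▸ (hcross u hu y hy hu0 hy1).1)
        (hxy ▸ (hcross x hx v hv hx0 hv1).1)) (hv1.trans hy1.symm)
    have hcard : ((s.erase y).image (doublingProj hC e)).card = (s.erase y).card := by
      refine Finset.card_image_of_injOn fun u hu v hv huv => ?_
      obtain ⟨huy, hu⟩ := Finset.mem_erase.1 (Finset.mem_coe.1 hu)
      obtain ⟨hvy, hv⟩ := Finset.mem_erase.1 (Finset.mem_coe.1 hv)
      refine hext u v huv ?_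
      cases hu2 : (e u).1.2 <;> cases hv2 : (e v).1.2
      · rfl
      · exact absurd (hunique u hu v hv huv hu2 hv2) hvy
      · exact absurd (hunique v hv u hu huv.symm hv2 hu2) huy
      · rfl
    rw [← Finset.card_erase_add_one hy, ← hcard]
    gcongr
    exact Finset.erase_subset _ _
  · have hcard : (s.image (doublingProj hC e)).card = s.card := by
      refine Finset.card_image_of_injOn fun u hu v hv huv => hext u v huv ?_
      cases hu2 : (e u).1.2 <;> cases hv2 : (e v).1.2
      · rfl
      · exact absurd ⟨u, hu, v, hv, huv, hu2, hv2⟩ hinj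
      · exact absurd ⟨v, hv, u, hu, huv.symm, hv2, hu2⟩ hinj
      · rfl
    omega

theorem coe_subset_spine {β : Type u} [Lattice β] {k : ℕ}
    (hk : ∀ s : Finset β, IsChain (· ≤ ·) (s : Set β) → s.card ≤ k + 1) {s : Finset β}
    (hs : IsChain (· ≤ ·) (s : Set β)) (hcard : s.card = k + 1) : (s : Set β) ⊆ spine β := by
  classical
  obtain ⟨f, hf, hrange⟩ : ∃ f : Fin (k + 1) → β, StrictMono f ∧ Set.range f = s := by
    let : LinearOrder (s : Set β) := hs.linearOrder
    let g := monoEquivOfFin (s : Set β) (k := k + 1) (by simpa using hcard)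
    refine ⟨fun i => (g i : β), fun _ _ h => g.strictMono h, ?_⟩
    change Set.range (Subtype.val ∘ g) = s
    rw [g.surjective.range_comp, Subtype.range_coe]
  have hlen : latLen β = k := by
    refine IsGreatest.csSup_eq ⟨⟨f, hf⟩, ?_⟩
    rintro m ⟨g, hg⟩
    have h := hk (Finset.univ.image g) (by
      simpa using hg.monotone.isChain_range)
    rw [Finset.card_image_of_injective _ hg.injective, Finset.card_fin] at h
    omega
  intro a ha
  unfold spine
  rw [Set.mem_ofPred_eq, hlen]
  exact ⟨f, hf, hrange ▸ ha⟩


/-- If a congruence normal lattice `L = E[C_1, …, C_n]`, obtained from the one-element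
lattice `K 0` by successively doubling nonempty convex subsets `C i` (so that
`K (i+1) ≅ (K i)[C i]` and `L = K n`), is shellable, then every `C i` intersects the
spine of `K i`. -/
theorem congruenceNormal_shellable_spine (n : ℕ) (K : Fin (n + 1) → Type u)
    [instK : ∀ i, Lattice (K i)] [instF : ∀ i, Fintype (K i)]
    (hone : Subsingleton (K 0)) (hone' : Nonempty (K 0))
    (C : (i : Fin n) → Set (K i.castSucc))
    (hne : ∀ i, (C i).Nonempty) (hconv : ∀ i, (C i).OrdConnected)
    (e : (i : Fin n) → (K i.succ ≃o Doubling (C i)))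
    (hsh : IsShellable (K (Fin.last n))) :
    ∀ i : Fin n, (C i ∩ spine (K i.castSucc)).Nonempty := by
  classical
  let L := K (Fin.last n)
  let step : (i : Fin n) → LatticeHom (K i.succ) (K i.castSucc) :=
    fun i => doublingProj (hconv i) (e i)
  let p : (i : Fin (n + 1)) → LatticeHom L (K i) :=
    Fin.reverseInduction (LatticeHom.id _) fun i g => (step i).comp g
  have hp : ∀ i : Fin n, p i.castSucc = (step i).comp (p i.succ) := fun i =>
    Fin.reverseInduction_castSucc i
  have hsurj : ∀ i, Function.Surjective (p i) := by
    intro i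
    induction i using Fin.reverseInduction with
    | last =>
      have : p (Fin.last n) = LatticeHom.id _ := Fin.reverseInduction_last
      rw [this]
      exact Function.surjective_id
    | cast i ih =>
      rw [hp, LatticeHom.coe_comp]
      exact (doublingProj_surjective (hconv i) (e i)).comp ih
  obtain ⟨s, hs, hmeets⟩ := hsh.exists_isMaxChain
  have hboth : ∀ i : Fin n, MeetsBothCopies (fun x => e i (p i.succ x)) (s : Set L) := by
    intro i
    obtain ⟨t, ht, htC⟩ :=
      exists_isMaxChain_meetsBothCopies (hne i) (e i) (p i.succ) (hsurj i.succ)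
    exact hmeets (hconv i) (e i) (p i.succ) ht htC
  have hupper : ∀ (i : Fin (n + 1)) (t : Finset (K i)), IsChain (· ≤ ·) (t : Set (K i)) →
      t.card ≤ i + 1 := by
    intro i
    induction i using Fin.induction with
    | zero => exact fun t _ => Finset.card_le_one_of_subsingleton t
    | succ i ih =>
      intro t ht
      have h₁ := ht.card_le_card_image_doublingProj_add_one (hconv i) (e i)
      have h₂ := ih (t.image (doublingProj (hconv i) (e i))) (by
        rw [Finset.coe_image]
        exact (OrderHomClass.mono _).isChain_image ht)
      simp only [Fin.val_castSucc, Fin.val_succ] at *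
      omega
  intro i
  obtain ⟨x, hx, y, hy, hxy, hx0, hy1⟩ := hboth i
  have himage_ne : ∀ j : Fin (n + 1), (s.image (p j)).Nonempty := fun j =>
    ⟨_, Finset.mem_image_of_mem _ hx⟩
  have hlower : ∀ j : Fin (n + 1), (j : ℕ) + 1 ≤ (s.image (p j)).card := by
    intro j
    induction j using Fin.induction with
    | zero => exact Finset.card_pos.2 (himage_ne 0)
    | succ j ih =>
      obtain ⟨u, hu, v, hv, huv, hu0, hv1⟩ := hboth j
      have himage : s.image (p j.castSucc) = (s.image (p j.succ)).image (step j) := by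
        rw [Finset.image_image, hp, LatticeHom.coe_comp]
      have hlt : (s.image (p j.castSucc)).card < (s.image (p j.succ)).card := by
        rw [himage]
        refine lt_of_le_of_ne Finset.card_image_le fun h => ?_
        have hinj := Finset.card_image_iff.1 h
        have heq : p j.succ u = p j.succ v :=
          hinj (Finset.mem_coe.2 (Finset.mem_image_of_mem _ hu))
            (Finset.mem_coe.2 (Finset.mem_image_of_mem _ hv)) huv
        dsimp only at hu0 hv1
        rw [heq, hv1] at hu0
        exact absurd hu0 (by decide)
      simp only [Fin.val_castSucc, Fin.val_succ] at *
      omega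
  have hchain : IsChain (· ≤ ·) (s.image (p i.castSucc) : Set (K i.castSucc)) := by
    rw [Finset.coe_image]
    exact (OrderHomClass.mono _).isChain_image hs.1
  have hpx : p i.castSucc x = (e i (p i.succ x)).1.1 := by rw [hp]; rfl
  refine ⟨p i.castSucc x, ?_, coe_subset_spine (hupper i.castSucc) hchain
    (le_antisymm (hupper _ _ hchain) (hlower _)) (Finset.mem_coe.2 (Finset.mem_image_of_mem _ hx))⟩
  rw [hpx]
  rcases (e i (p i.succ x)).2 with h | h
  · rcases (e i (p i.succ y)).2 with h' | h'
    · exact absurd (hy1.symm.trans h'.1) (by decide)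
    · dsimp only at hxy
      rw [← hxy] at h'
      exact h'.2.resolve_left (not_not_intro h.2)
  · exact absurd (hx0.symm.trans h.1) (by decide)
end

section
/- Let L be a congruence uniform lattice. Then the following are equivalent: (i) L is extremal; (ii) L is left modular; (iii) L is shellable. -/
universe u

/-- A join-irreducible element of a finite lattice: an element covering exactly one element. -/
def IsJoinIrred {α : Type u} [Lattice α] (j : α) : Prop := ∃! b : α, b ⋖ j

/-- A meet-irreducible element of a finite lattice: an element covered by exactly one element. -/
def IsMeetIrred {α : Type u} [Lattice α] (m : α) : Prop := ∃! b : α, m ⋖ b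

/-- A finite lattice is extremal if `ℓ(L) = |JIrr(L)| = |MIrr(L)|`. -/
noncomputable def IsExtremal (β : Type u) [Lattice β] : Prop :=
  latLen β = {j : β | IsJoinIrred j}.ncard ∧ latLen β = {m : β | IsMeetIrred m}.ncard

/-- An element `a` of a lattice is left modular if for all `b < c`,
`(b ⊔ a) ⊓ c = b ⊔ (a ⊓ c)`. -/
def LeftModular {α : Type u} [Lattice α] (a : α) : Prop :=
  ∀ b c : α, b < c → (b ⊔ a) ⊓ c = b ⊔ (a ⊓ c)

/-- A lattice is left modular if it has a maximal chain all of whose elements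
are left modular. -/
def IsLeftModularLattice (β : Type u) [Lattice β] : Prop :=
  ∃ s : Set β, IsMaxChain (· ≤ ·) s ∧ ∀ a ∈ s, LeftModular a

/-- `γ` is (isomorphic to) the doubling of the lattice `β` by a nonempty interval. -/
def IsDoublingOfInterval (γ β : Type u) [iγ : Lattice γ] [iβ : Lattice β] : Prop :=
  ∃ a b : β, a ≤ b ∧ Nonempty (γ ≃o Doubling (Set.Icc a b))

/-- `γ` is order-isomorphic to `β`. -/
def LatOrderIso (γ β : Type u) [iγ : Lattice γ] [iβ : Lattice β] : Prop :=
  Nonempty (γ ≃o β)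

/-- A finite lattice is congruence uniform if it is obtained from the one-element lattice
by a finite sequence of doublings of nonempty intervals. -/
def IsCongruenceUniform (β : Type u) [Lattice β] : Prop :=
  ∃ (n : ℕ) (K : Fin (n + 1) → Type u) (instK : ∀ i, Lattice (K i)),
    (Subsingleton (K 0) ∧ Nonempty (K 0)) ∧
    (∀ i : Fin n, IsDoublingOfInterval (K i.succ) (K i.castSucc)
      (iγ := instK i.succ) (iβ := instK i.castSucc)) ∧
    LatOrderIso β (K (Fin.last n)) (iβ := instK (Fin.last n))

section MaximalChains

variable {α : Type u} [Lattice α] {F : Set α}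

theorem IsMaxChain.mem_of_comparable (hF : IsMaxChain (· ≤ ·) F) {w : α}
    (hw : ∀ f ∈ F, w ≤ f ∨ f ≤ w) : w ∈ F := by
  have h : IsChain (· ≤ ·) (insert w F) := hF.1.insert fun b hb _ => hw b hb
  rw [hF.2 h (Set.subset_insert w F)]
  exact Set.mem_insert w F

/-- A maximal chain crosses every down-closed cut along a cover relation. -/
theorem IsMaxChain.exists_covBy_cut [Finite α] (hF : IsMaxChain (· ≤ ·) F) (P : α → Prop)
    (hP : ∀ x y, x ≤ y → P y → P x) {x y : α} (hx : x ∈ F) (hPx : P x)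
    (hy : y ∈ F) (hPy : ¬ P y) :
    ∃ u ∈ F, ∃ v ∈ F, u ⋖ v ∧ P u ∧ ¬ P v := by
  obtain ⟨u, hu⟩ := (Set.toFinite {f | f ∈ F ∧ P f}).exists_maximal ⟨x, hx, hPx⟩
  obtain ⟨v, hv⟩ := (Set.toFinite {f | f ∈ F ∧ ¬ P f}).exists_minimal ⟨y, hy, hPy⟩
  have below : ∀ f ∈ F, P f → f ≤ u := fun f hf hPf =>
    (hF.1.total hf hu.1.1).elim id fun h => hu.2 ⟨hf, hPf⟩ h
  have above : ∀ f ∈ F, ¬ P f → v ≤ f := fun f hf hPf =>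
    (hF.1.total hv.1.1 hf).elim id fun h => hv.2 ⟨hf, hPf⟩ h
  have huv : u ≤ v := (hF.1.total hu.1.1 hv.1.1).elim id fun h =>
    absurd (hP _ _ h hu.1.2) hv.1.2
  refine ⟨u, hu.1.1, v, hv.1.1, ⟨lt_of_le_of_ne huv ?_, ?_⟩, hu.1.2, hv.1.2⟩
  · rintro rfl
    exact hv.1.2 hu.1.2
  · intro w huw hwv
    have hwF : w ∈ F := hF.mem_of_comparable fun f hf => by
      by_cases hPf : P f
      · exact Or.inr ((below f hf hPf).trans huw.le)
      · exact Or.inl (hwv.le.trans (above f hf hPf))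
    by_cases hPw : P w
    · exact huw.not_ge (below w hwF hPw)
    · exact hwv.not_ge (above w hwF hPw)

variable [BoundedOrder α] [Finite α]

theorem IsMaxChain.exists_covBy_left (hF : IsMaxChain (· ≤ ·) F) {v : α} (hv : v ∈ F)
    (hbot : v ≠ ⊥) : ∃ u ∈ F, u ⋖ v := by
  obtain ⟨u, hu, w, hw, huw, h1, h2⟩ := hF.exists_covBy_cut (· < v)
    (fun x y h1 h2 => h1.trans_lt h2) hF.bot_mem (bot_lt_iff_ne_bot.2 hbot) hv (lt_irrefl v)
  have hvw : v ≤ w := (hF.1.total hv hw).elim id fun h => not_lt_iff_le_imp_ge.1 h2 h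
  obtain h | h := huw.eq_or_eq h1.le hvw
  · exact absurd h h1.ne'
  · exact ⟨u, hu, h ▸ huw⟩

theorem IsMaxChain.exists_covBy_right (hF : IsMaxChain (· ≤ ·) F) {u : α} (hu : u ∈ F)
    (htop : u ≠ ⊤) : ∃ v ∈ F, u ⋖ v := by
  obtain ⟨w, hw, v, hv, hwv, h1, h2⟩ := hF.exists_covBy_cut (· ≤ u)
    (fun x y h1 h2 => h1.trans h2) hu le_rfl hF.top_mem (fun h => htop (top_le_iff.1 h))
  have huv : u ≤ v := (hF.1.total hu hv).elim id fun h => absurd h h2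
  obtain h | h := hwv.eq_or_eq h1 huv
  · exact ⟨v, hv, h ▸ hwv⟩
  · exact absurd h.ge h2

end MaximalChains

section WeightedSums

/-- Comparing finite sets by weights that grow fast: the set owning the heaviest element of the
symmetric difference has the larger total weight. -/
theorem Finset.sum_pow_lt_sum_pow {ι : Type*} (ρ : ι → ℕ) {N : ℕ} {A B : Finset ι}
    (hB : B.card < N) {r : ι} (hrA : r ∈ A) (hrB : r ∉ B)
    (h : ∀ b ∈ B, b ∉ A → ρ b < ρ r) :
    ∑ b ∈ B, N ^ ρ b < ∑ a ∈ A, N ^ ρ a := by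
  classical
  have hN : 0 < N := by omega
  rw [← Finset.sum_inter_add_sum_sdiff B A, ← Finset.sum_inter_add_sum_sdiff A B,
    Finset.inter_comm]
  refine Nat.add_lt_add_left ?_ _
  have h2 : N ^ ρ r ≤ ∑ a ∈ A \ B, N ^ ρ a :=
    Finset.single_le_sum (f := fun a => N ^ ρ a) (fun _ _ => Nat.zero_le _)
      (Finset.mem_sdiff.2 ⟨hrA, hrB⟩)
  refine lt_of_lt_of_le ?_ h2
  rcases Nat.eq_zero_or_pos (ρ r) with h0 | h0
  · have : B \ A = ∅ := by
      ext b
      simp only [Finset.mem_sdiff, Finset.notMem_empty, iff_false, not_and, not_not]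
      intro hb
      by_contra hbA
      have := h b hb hbA
      omega
    rw [this, Finset.sum_empty]
    positivity
  · obtain ⟨m, hm⟩ : ∃ m, ρ r = m + 1 := ⟨ρ r - 1, by omega⟩
    have h3 : ∑ b ∈ B \ A, N ^ ρ b ≤ (B \ A).card * N ^ m := by
      rw [← smul_eq_mul]
      refine Finset.sum_le_card_nsmul _ _ _ fun b hb => Nat.pow_le_pow_right hN ?_
      have := h b (Finset.mem_sdiff.1 hb).1 (Finset.mem_sdiff.1 hb).2
      omega
    have h4 : (B \ A).card < N := (Finset.card_le_card Finset.sdiff_subset).trans_lt hB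
    rw [hm, pow_succ']
    exact h3.trans_lt (Nat.mul_lt_mul_of_pos_right h4 (pow_pos hN m))

end WeightedSums

section LeftModularChains

variable {α : Type u} [Lattice α]

theorem LeftModular.eq_of_le {a b c : α} (ha : LeftModular a) (h : b ≤ c) :
    (b ⊔ a) ⊓ c = b ⊔ (a ⊓ c) := by
  rcases h.eq_or_lt with rfl | h
  · rw [inf_comm a b, sup_inf_self, inf_comm, inf_sup_self]
  · exact ha b c h

/-- A chain of left modular elements from `⊥` to `⊤`, indexed by `ℕ`, eventually constant and
with steps that are covers or equalities. -/
structure IsLeftModularSeq [BoundedOrder α] (c : ℕ → α) (n : ℕ) : Prop where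
  zero : c 0 = ⊥
  last : c n = ⊤
  wcovBy : ∀ i, c i ⩿ c (i + 1)
  leftModular : ∀ i, LeftModular (c i)

theorem IsLeftModularLattice.exists_isLeftModularSeq [BoundedOrder α] [Finite α]
    (h : IsLeftModularLattice α) : ∃ (c : ℕ → α) (n : ℕ), IsLeftModularSeq c n := by
  classical
  obtain ⟨F, hF, hlm⟩ := h
  have step : ∀ x : F, ∃ y : F, (x : α) ⩿ y ∧ ((x : α) ≠ ⊤ → (x : α) < y) := fun x => by
    by_cases hx : (x : α) = ⊤
    · exact ⟨x, WCovBy.rfl, fun h => absurd hx h⟩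
    · obtain ⟨v, hv, hxv⟩ := hF.exists_covBy_right x.2 hx
      exact ⟨⟨v, hv⟩, hxv.wcovBy, fun _ => hxv.lt⟩
  choose next hnext hlt using step
  let c : ℕ → F := fun i => next^[i] ⟨⊥, hF.bot_mem⟩
  have hc : ∀ i, c (i + 1) = next (c i) := fun i => Function.iterate_succ_apply' next i _
  have hmono : Monotone fun i => (c i : α) :=
    monotone_nat_of_le_succ fun i => by rw [hc]; exact (hnext _).le
  obtain ⟨n, hn⟩ : ∃ n, (c n : α) = ⊤ := by
    by_contra! hne
    have : StrictMono fun i => (c i : α) :=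
      strictMono_nat_of_lt_succ fun i => by rw [hc]; exact hlt _ (hne i)
    exact not_injective_infinite_finite _ this.injective
  exact ⟨fun i => c i, n, rfl, hn, fun i => by rw [hc]; exact hnext _, fun i => hlm _ (c i).2⟩

namespace IsLeftModularSeq

variable {c : ℕ → α} {n : ℕ}

open Classical in
/-- The indices of the steps of the chain that are not absorbed by joining with `p`. -/
noncomputable def unabsorbed (c : ℕ → α) (n : ℕ) (p : α) : Finset ℕ :=
  {i ∈ Finset.range n | ¬ c (i + 1) ≤ p ⊔ c i}

theorem mem_unabsorbed {p : α} {i : ℕ} :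
    i ∈ unabsorbed c n p ↔ i < n ∧ ¬ c (i + 1) ≤ p ⊔ c i := by
  simp [unabsorbed]

theorem unabsorbed_antitone {p q : α} (h : p ≤ q) : unabsorbed c n q ⊆ unabsorbed c n p :=
  fun i hi => by
    rw [mem_unabsorbed] at hi ⊢
    exact ⟨hi.1, fun h' => hi.2 (h'.trans (sup_le_sup_right h _))⟩

/-- The numerical value used to compare elements. -/
noncomputable def rank (c : ℕ → α) (n : ℕ) (p : α) : ℕ :=
  ∑ i ∈ unabsorbed c n p, (n + 1) ^ i

theorem card_unabsorbed_lt (p : α) : (unabsorbed c n p).card < n + 1 := by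
  have : (unabsorbed c n p).card ≤ (Finset.range n).card := by
    classical
    exact Finset.card_le_card fun i hi => Finset.mem_range.2 (mem_unabsorbed.1 hi).1
  rw [Finset.card_range] at this
  omega

variable [BoundedOrder α]

theorem monotone (hc : IsLeftModularSeq c n) : Monotone c :=
  monotone_nat_of_le_succ fun i => (hc.wcovBy i).le

/-- The first index at which the chain distinguishes `q` from a smaller-or-incomparable `p`. -/
theorem exists_first (hc : IsLeftModularSeq c n) {p q : α} (h : ¬ q ≤ p) :
    ∃ i, i < n ∧ c i ⊓ q ≤ p ∧ ¬ c (i + 1) ⊓ q ≤ p := by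
  classical
  have hex : ∃ k, ¬ c k ⊓ q ≤ p := ⟨n, by rwa [hc.last, top_inf_eq]⟩
  have hspec := Nat.find_spec hex
  have hmin : ∀ m, m < Nat.find hex → c m ⊓ q ≤ p := fun m hm => by
    simpa using Nat.find_min hex hm
  have hle : Nat.find hex ≤ n := Nat.find_min' hex (by rwa [hc.last, top_inf_eq])
  rcases hi : Nat.find hex with _ | i
  · have h0 := hi
    rw [h0, hc.zero, bot_inf_eq] at hspec
    exact absurd bot_le hspec
  · rw [hi] at hspec hle hmin
    exact ⟨i, hle, hmin i (by omega), hspec⟩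

theorem le_sup_of_first (hc : IsLeftModularSeq c n) {p q : α} {i : ℕ}
    (h1 : c i ⊓ q ≤ p) (h2 : ¬ c (i + 1) ⊓ q ≤ p) : c (i + 1) ≤ q ⊔ c i := by
  obtain h | h := (hc.wcovBy i).eq_or_eq (c := c i ⊔ (c (i + 1) ⊓ q)) le_sup_left
    (sup_le (hc.wcovBy i).le inf_le_left)
  · exact absurd ((le_inf (sup_eq_left.1 h) inf_le_right).trans h1) h2
  · rw [← h]
    exact sup_le le_sup_right (inf_le_right.trans le_sup_left)

theorem not_le_sup_of_first (hc : IsLeftModularSeq c n) {p q : α} {i : ℕ} (hpq : p ≤ q)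
    (h1 : c i ⊓ q ≤ p) (h2 : ¬ c (i + 1) ⊓ q ≤ p) : ¬ c (i + 1) ≤ p ⊔ c i := fun h => by
  refine h2 ((inf_le_inf_right q h).trans ?_)
  rw [(hc.leftModular i).eq_of_le hpq, sup_eq_left.2 h1]

theorem covBy_of_first (hc : IsLeftModularSeq c n) {x y : α} {i : ℕ} (hxy : x ≤ y)
    (h1 : c i ⊓ y ≤ x) (h2 : ¬ c (i + 1) ⊓ y ≤ x) : x ⋖ x ⊔ (c (i + 1) ⊓ y) := by
  refine ⟨left_lt_sup.2 h2, fun w hxw hwr => ?_⟩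
  have hwy : w ≤ y := hwr.le.trans (sup_le hxy inf_le_right)
  have hw : ¬ c (i + 1) ⊓ w ≤ x := fun h => by
    have := (hc.leftModular (i + 1)).eq_of_le hxw.le
    rw [sup_eq_left.2 h] at this
    have hwx : w ≤ (x ⊔ c (i + 1)) ⊓ w :=
      le_inf (hwr.le.trans (sup_le_sup_left inf_le_left x)) le_rfl
    exact hxw.not_ge (hwx.trans this.le)
  have hle := hc.le_sup_of_first ((inf_le_inf_left _ hwy).trans h1) hw
  refine hwr.not_ge (sup_le hxw.le ((inf_le_inf_right y hle).trans ?_))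
  rw [(hc.leftModular i).eq_of_le hwy]
  exact sup_le le_rfl (h1.trans hxw.le)

theorem rank_lt_of_lt (hc : IsLeftModularSeq c n) {p q : α} (h : p < q) :
    rank c n q < rank c n p := by
  obtain ⟨i, hi, h1, h2⟩ := hc.exists_first h.not_ge
  refine Finset.sum_pow_lt_sum_pow id (card_unabsorbed_lt q) (r := i)
    (mem_unabsorbed.2 ⟨hi, hc.not_le_sup_of_first h.le h1 h2⟩)
    (fun h' => (mem_unabsorbed.1 h').2 (hc.le_sup_of_first h1 h2)) fun b hb hb' =>
    absurd (unabsorbed_antitone h.le hb) hb'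

/-- The step from `x` to `z` uses the earliest possible index among the steps from `x` towards
`y`. -/
def IsAscent (c : ℕ → α) (x z y : α) : Prop := ∀ k, c k ⊓ z ≤ x → c k ⊓ y ≤ x

theorem rank_lt_of_isAscent (hc : IsLeftModularSeq c n) {x z y f : α} (hxz : x ⋖ z)
    (hzy : z ≤ y) (hasc : IsAscent c x z y) (hxf : x < f) (hfy : f ≤ y) (hzf : ¬ z ≤ f) :
    rank c n f < rank c n z := by
  obtain ⟨i, -, hi1, hi2⟩ := hc.exists_first hxz.lt.not_ge
  obtain ⟨j, hjn, hj1, hj2⟩ := hc.exists_first hxf.not_ge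
  have hxy := hxf.le.trans hfy
  have hij : i ≤ j := by
    by_contra! hlt
    have : c (j + 1) ⊓ z ≤ x := (inf_le_inf_right z (hc.monotone hlt)).trans hi1
    exact hj2 ((inf_le_inf_left _ hfy).trans (hasc _ this))
  have hz : z ≤ x ⊔ c (i + 1) := by
    obtain h | h := hxz.eq_or_eq (c := x ⊔ (c (i + 1) ⊓ z)) le_sup_left
      (sup_le hxz.le inf_le_right)
    · exact absurd (sup_eq_left.1 h) hi2
    · exact h.ge.trans (sup_le_sup_left inf_le_left x)
  have hne : i ≠ j := by
    rintro rfl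
    have hcov := hc.covBy_of_first hxy (hasc i hi1)
      fun h => hi2 ((inf_le_inf_left _ hzy).trans h)
    have hzr : z ≤ x ⊔ (c (i + 1) ⊓ y) := by
      rw [← (hc.leftModular (i + 1)).eq_of_le hxy]
      exact le_inf hz hzy
    obtain h | h := hcov.eq_or_eq hxz.le hzr
    · exact hxz.ne h.symm
    · have hle : x ⊔ (c (i + 1) ⊓ f) ≤ z :=
        (sup_le_sup_left (inf_le_inf_left _ hfy) x).trans h.ge
      obtain h' | h' := hxz.eq_or_eq le_sup_left hle
      · exact hj2 (sup_eq_left.1 h')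
      · exact hzf (h'.ge.trans (sup_le hxf.le inf_le_right))
  have key : ∀ k, j ≤ k → z ⊔ c k ≤ x ⊔ c k := fun k hk =>
    sup_le (hz.trans (sup_le_sup_left (hc.monotone (by omega)) x)) le_sup_right
  refine Finset.sum_pow_lt_sum_pow id (card_unabsorbed_lt f) (r := j)
    (mem_unabsorbed.2 ⟨hjn, fun h => hc.not_le_sup_of_first hxf.le hj1 hj2
      (h.trans (key j le_rfl))⟩)
    (fun h' => (mem_unabsorbed.1 h').2 (hc.le_sup_of_first hj1 hj2)) fun b hb hb' => ?_
  by_contra! hjb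
  have hbx := mem_unabsorbed.1 (unabsorbed_antitone hxf.le hb)
  exact hb' (mem_unabsorbed.2 ⟨hbx.1, fun h => hbx.2 (h.trans (key b hjb))⟩)

/-- Local ascents along a maximal chain add up. -/
theorem isAscent_of_local [Finite α] {G : Set α} (hG : IsMaxChain (· ≤ ·) G) {y : α}
    (hy : y ∈ G) (x z : α) (hx : x ∈ G) (hz : z ∈ G) (hxz : x ⋖ z) (hzy : z ≤ y)
    (h : ∀ u ∈ G, ∀ w ∈ G, ∀ v ∈ G, x < w → w < y → u ⋖ w → w ⋖ v → IsAscent c u w v) :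
    IsAscent c x z y := by
  induction x using WellFoundedGT.induction generalizing z with
  | ind x ih =>
    rcases hzy.eq_or_lt with rfl | hzy
    · exact fun k hk => hk
    · obtain ⟨v, hv, hzv⟩ := hG.exists_covBy_right hz (hzy.trans_le le_top).ne
      have hvy : v ≤ y := (hG.1.total hv hy).elim id fun hyv =>
        (hzv.eq_or_eq hzy.le hyv).elim (fun e => absurd e hzy.ne') fun e => e.ge
      intro k hk
      have h1 := h x hx z hz v hv hxz.lt hzy hxz hzv k hk
      have h2 := ih z hxz.lt v hz hv hzv hvy
        (fun u hu w hw t ht hzw => h u hu w hw t ht (hxz.lt.trans hzw)) k (h1.trans hxz.le)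
      exact (le_inf inf_le_left h2).trans hk

end IsLeftModularSeq

end LeftModularChains

section Shelling

variable {α : Type u} [Lattice α] [Fintype α] {c : ℕ → α} {n : ℕ}

/-- The weight by which maximal chains are sorted to obtain a shelling. -/
noncomputable def chainWeight (c : ℕ → α) (n : ℕ) (F : Finset α) : ℕ :=
  ∑ f ∈ F, (Fintype.card α + 1) ^ IsLeftModularSeq.rank c n f

theorem chainWeight_lt {F G : Finset α} {r : α} (hrG : r ∈ G) (hrF : r ∉ F)
    (h : ∀ f ∈ F, f ∉ G → IsLeftModularSeq.rank c n f < IsLeftModularSeq.rank c n r) :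
    chainWeight c n F < chainWeight c n G :=
  Finset.sum_pow_lt_sum_pow _ (Nat.lt_succ_of_le (Finset.card_le_univ F)) hrG hrF h

variable [BoundedOrder α]

open IsLeftModularSeq in
/-- At an element of a maximal chain which is not an ascent, the chain can be exchanged for a
heavier one. -/
theorem IsLeftModularSeq.exists_heavier (hc : IsLeftModularSeq c n) {G : Finset α}
    (hG : IsMaxChain (· ≤ ·) (G : Set α)) {x z y : α} (hx : x ∈ G) (hz : z ∈ G) (hy : y ∈ G)
    (hxz : x ⋖ z) (hzy : z ⋖ y) (hdesc : ¬ IsAscent c x z y) :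
    ∃ H : Finset α, IsMaxChain (· ≤ ·) (H : Set α) ∧ chainWeight c n G < chainWeight c n H ∧
      z ∉ H ∧ ∀ g ∈ G, g ≠ z → g ∈ H := by
  classical
  have hxy : x < y := hxz.lt.trans hzy.lt
  unfold IsAscent at hdesc
  push Not at hdesc
  obtain ⟨k, hk1, hk2⟩ := hdesc
  obtain ⟨i, -, hi1, hi2⟩ := hc.exists_first hxy.not_ge
  have hik : i + 1 ≤ k := by
    by_contra! hlt
    exact hk2 ((inf_le_inf_right y (hc.monotone (Nat.le_of_lt_succ hlt))).trans hi1)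
  have hcov := hc.covBy_of_first hxy.le hi1 hi2
  set r := x ⊔ (c (i + 1) ⊓ y) with hr
  have hry : r ≤ y := sup_le hxy.le inf_le_right
  have hir : ¬ c (i + 1) ⊓ r ≤ x := fun h => hi2 ((le_inf inf_le_left le_sup_right).trans h)
  have hne : r ≠ z := by
    intro h
    rw [h] at hir
    exact hir ((inf_le_inf_right z (hc.monotone hik)).trans hk1)
  have hasc : IsAscent c x r y := fun l hl => by
    have : l ≤ i := by
      by_contra! hlt
      exact hir ((inf_le_inf_right r (hc.monotone hlt)).trans hl)
    exact (inf_le_inf_right y (hc.monotone this)).trans hi1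
  have hrz : ¬ r ≤ z := fun h => (hxz.eq_or_eq hcov.le h).elim hcov.ne' hne
  have hzr : ¬ z ≤ r := fun h => (hcov.eq_or_eq hxz.le h).elim hxz.ne' hne.symm
  have hchain : IsChain (· ≤ ·) (insert r ((G : Set α) \ {z})) := by
    refine hG.1.diff.insert fun g hg _ => ?_
    rcases hG.1.total hg.1 hz with hgz | hzg
    · rcases hG.1.total hg.1 hx with hgx | hxg
      · exact Or.inr (hgx.trans hcov.le)
      · rcases hxz.eq_or_eq hxg hgz with e | e
        · exact Or.inr (e.le.trans hcov.le)
        · exact absurd e hg.2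
    · rcases hG.1.total hg.1 hy with hgy | hyg
      · rcases hzy.eq_or_eq hzg hgy with e | e
        · exact absurd e hg.2
        · exact Or.inl (hry.trans e.ge)
      · exact Or.inl (hry.trans hyg)
  obtain ⟨M, hM, hsub⟩ := hchain.exists_maxChain
  have hrM : r ∈ M := hsub (Set.mem_insert _ _)
  have hzM : z ∉ M := fun h => (hM.1.total h hrM).elim hzr hrz
  have hGM : ∀ g ∈ G, g ≠ z → g ∈ M := fun g hg hgz =>
    hsub (Set.mem_insert_of_mem _ ⟨hg, hgz⟩)
  refine ⟨M.toFinset, by rwa [Set.coe_toFinset], chainWeight_lt (r := r) (by simpa using hrM)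
    (fun h => (hG.1.total h hz).elim hrz hzr) fun f hf hf' => ?_, by simpa using hzM,
    by simpa using hGM⟩
  have : f = z := by
    by_contra hfz
    exact hf' (by simpa using hGM f hf hfz)
  rw [this]
  exact hc.rank_lt_of_isAscent hcov hry hasc hxz.lt hzy.le hrz

open IsLeftModularSeq in
/-- A maximal chain that only has ascents outside `F` is heavier than `F`. -/
theorem IsLeftModularSeq.chainWeight_lt_of_isAscent (hc : IsLeftModularSeq c n) {F G : Finset α}
    (hF : IsMaxChain (· ≤ ·) (F : Set α)) (hG : IsMaxChain (· ≤ ·) (G : Set α)) (hne : F ≠ G)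
    (hasc : ∀ x ∈ G, ∀ z ∈ G, ∀ y ∈ G, z ∉ F → x ⋖ z → z ⋖ y → IsAscent c x z y) :
    chainWeight c n F < chainWeight c n G := by
  have hex : ∃ z, z ∈ G ∧ z ∉ F := by
    by_contra! hsub
    exact hne (Finset.coe_injective (hG.2 hF.1 hsub)).symm
  obtain ⟨z, ⟨hzG, hzF⟩, hzmin⟩ := (Set.toFinite {z | z ∈ G ∧ z ∉ F}).exists_minimal hex
  have hlow : ∀ g ∈ G, g < z → g ∈ F := fun g hg hgz => by
    by_contra hgF
    exact hgz.not_ge (hzmin ⟨hg, hgF⟩ hgz.le)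
  obtain ⟨x, hxG, hxz⟩ := hG.exists_covBy_left hzG fun h => hzF (h ▸ hF.bot_mem)
  have hxF := hlow x hxG hxz.lt
  obtain ⟨y, ⟨hyF, hyG, hzy⟩, hymin⟩ :=
    (Set.toFinite {y | y ∈ F ∧ y ∈ G ∧ z ≤ y}).exists_minimal ⟨⊤, hF.top_mem, hG.top_mem, le_top⟩
  have hascy : IsAscent c x z y := by
    refine isAscent_of_local hG hyG x z hxG hzG hxz hzy
      fun u hu w hw v hv hxw hwy huw hwv => hasc u hu w hw v hv (fun hwF => ?_) huw hwv
    rcases hG.1.total hzG hw with h | h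
    · exact hwy.not_ge (hymin ⟨hwF, hw, h⟩ hwy.le)
    · rcases hxz.eq_or_eq hxw.le h with e | e
      · exact hxw.ne' e
      · exact hzF (e ▸ hwF)
  refine chainWeight_lt hzG hzF fun f hfF hfG => ?_
  have hxf : x < f := by
    refine lt_of_le_of_ne ?_ fun h => hfG (h ▸ hxG)
    by_contra hxf
    have hfx : f ≤ x := (hF.1.total hfF hxF).elim id fun h => absurd h hxf
    refine hfG (hG.mem_of_comparable fun g hg => ?_)
    rcases hG.1.total hg hxG with h | h
    · exact hF.1.total hfF (hlow g hg (h.trans_lt hxz.lt))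
    · exact Or.inl (hfx.trans h)
  by_cases hzf : z ≤ f
  · exact hc.rank_lt_of_lt (lt_of_le_of_ne hzf fun h => hzF (h ▸ hfF))
  · refine hc.rank_lt_of_isAscent hxz hzy hascy hxf ?_ hzf
    exact (hF.1.total hfF hyF).elim id fun h => absurd (hzy.trans h) hzf

theorem IsLeftModularLattice.isShellable (h : IsLeftModularLattice α) : IsShellable α := by
  classical
  obtain ⟨c, n, hc⟩ := h.exists_isLeftModularSeq
  let S := {F : Finset α // IsMaxChain (· ≤ ·) (F : Set α)}
  let e : Fin (Fintype.card S) ≃ S := (Fintype.equivFin S).symm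
  let w : Fin (Fintype.card S) → ℕᵒᵈ := fun i => OrderDual.toDual (chainWeight c n (e i).1)
  let E : Fin (Fintype.card S) ≃ S := (Tuple.sort w).trans e
  have hanti : ∀ i j, i ≤ j → chainWeight c n (E j).1 ≤ chainWeight c n (E i).1 :=
    fun i j hij => Tuple.monotone_sort w hij
  refine ⟨Fintype.card S, fun i => (E i).1, Subtype.val_injective.comp E.injective,
    fun s => ⟨fun hs => ?_, ?_⟩, fun i j hij => ?_⟩
  · refine ⟨E.symm ⟨s.toFinset, by simpa using hs⟩, ?_⟩
    simp
  · rintro ⟨i, rfl⟩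
    exact (E i).2
  · have hne : (E i).1 ≠ (E j).1 := fun h =>
      hij.ne (E.injective (Subtype.val_injective h))
    have hdesc : ∃ x ∈ (E j).1, ∃ z ∈ (E j).1, ∃ y ∈ (E j).1, z ∉ (E i).1 ∧ x ⋖ z ∧ z ⋖ y ∧
        ¬ IsLeftModularSeq.IsAscent c x z y := by
      by_contra! hasc
      exact (hc.chainWeight_lt_of_isAscent (E i).2 (E j).2 hne hasc).not_ge (hanti i j hij.le)
    obtain ⟨x, hx, z, hz, y, hy, hzi, hxz, hzy, hd⟩ := hdesc
    obtain ⟨H, hH, hlt, hzH, hsub⟩ := hc.exists_heavier (E j).2 hx hz hy hxz hzy hd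
    refine ⟨E.symm ⟨H, hH⟩, ?_, ?_, ?_⟩
    · by_contra! hle
      have := hanti _ _ hle
      rw [Equiv.apply_symm_apply] at this
      exact hlt.not_ge this
    · beta_reduce
      rw [Equiv.apply_symm_apply]
      intro g hg
      rw [Finset.mem_inter] at hg ⊢
      exact ⟨hsub g hg.2 fun h => hzi (h ▸ hg.1), hg.2⟩
    · beta_reduce
      rw [Equiv.apply_symm_apply, ← Finset.card_erase_of_mem hz]
      congr 1
      ext g
      rw [Finset.mem_inter, Finset.mem_erase]
      exact ⟨fun hg => ⟨fun h => hzH (h ▸ hg.1), hg.2⟩, fun hg => ⟨hsub g hg.2 hg.1, hg.2⟩⟩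

end Shelling

section DoublingMaps

/-- An order-theoretic, self-dual description of the projection `π` from the doubling of an
interval onto the original lattice: `[a₀, b₀]` and `[a₁, b₁]` are the lower and the upper copy of
the interval, and `σ k` and `τ k` are the least and the greatest element above `k`. -/
structure IsDoublingMap {L K : Type*} [Lattice L] [Lattice K] (π : L → K) (σ τ : K → L)
    (a₀ a₁ b₀ b₁ : L) : Prop where
  gc_left : GaloisConnection σ π
  gc_right : GaloisConnection π τ
  map_left : ∀ k, π (σ k) = k
  map_right : ∀ k, π (τ k) = k
  le_or : ∀ x y, π x ≤ π y → x ≤ y ∨ (a₁ ≤ x ∧ x ≤ b₁ ∧ a₀ ≤ y ∧ y ≤ b₀)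
  map_bot : π a₀ = π a₁
  map_top : π b₀ = π b₁
  le_of_not_le : ∀ w, a₀ ≤ w → ¬ w ≤ b₀ → a₁ ≤ w
  ge_of_not_ge : ∀ w, w ≤ b₁ → ¬ a₁ ≤ w → w ≤ b₀
  bot_le_bot : a₀ ≤ a₁
  top_le_top : b₀ ≤ b₁
  bot_le_top₀ : a₀ ≤ b₀
  bot_le_top₁ : a₁ ≤ b₁
  not_le : ¬ a₁ ≤ b₀

theorem IsDoublingOfInterval.exists_isDoublingMap {L K : Type u} [Lattice L] [Lattice K]
    (h : IsDoublingOfInterval L K) :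
    ∃ (π : L → K) (σ τ : K → L) (a₀ a₁ b₀ b₁ : L), IsDoublingMap π σ τ a₀ a₁ b₀ b₁ := by
  classical
  obtain ⟨a, b, hab, ⟨e⟩⟩ := h
  have hI : ∀ x, x ∈ lowerIdeal (Set.Icc a b) ↔ x ≤ b := fun x =>
    ⟨fun ⟨y, hy, hxy⟩ => hxy.trans hy.2, fun hx => ⟨b, ⟨hab, le_rfl⟩, hx⟩⟩
  have hmem : ∀ x i, (x, i) ∈ doublingSet (Set.Icc a b) ↔
      (i = false ∧ x ≤ b) ∨ (i = true ∧ (x ≤ b → a ≤ x)) := fun x i => by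
    simp only [doublingSet, Set.mem_ofPred_eq, hI, Set.mem_Icc]
    tauto
  let lo : K → Doubling (Set.Icc a b) := fun k =>
    if h : k ≤ b then ⟨(k, false), (hmem _ _).2 (Or.inl ⟨rfl, h⟩)⟩
    else ⟨(k, true), (hmem _ _).2 (Or.inr ⟨rfl, fun h' => absurd h' h⟩)⟩
  let hi : K → Doubling (Set.Icc a b) := fun k =>
    if h : k ≤ b → a ≤ k then ⟨(k, true), (hmem _ _).2 (Or.inr ⟨rfl, h⟩)⟩
    else ⟨(k, false), (hmem _ _).2 (Or.inl ⟨rfl, by tauto⟩)⟩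
  have hle : ∀ x y, x ≤ y ↔ (e x).1.1 ≤ (e y).1.1 ∧ (e x).1.2 ≤ (e y).1.2 := fun x y => by
    rw [← e.le_iff_le]; rfl
  have hlo1 : ∀ k, (lo k).1.1 = k := fun k => by simp only [lo]; split_ifs <;> rfl
  have hhi1 : ∀ k, (hi k).1.1 = k := fun k => by simp only [hi]; split_ifs <;> rfl
  have hlo2 : ∀ k, (lo k).1.2 = true ↔ ¬ k ≤ b := fun k => by
    simp only [lo]; split_ifs with h <;> simp [h]
  have hhi2 : ∀ k, (hi k).1.2 = true ↔ (k ≤ b → a ≤ k) := fun k => by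
    simp only [hi]
    split_ifs with h
    · exact iff_of_true rfl h
    · exact iff_of_false (by simp) h
  have hx : ∀ x, ((e x).1.2 = false ∧ (e x).1.1 ≤ b) ∨
      ((e x).1.2 = true ∧ ((e x).1.1 ≤ b → a ≤ (e x).1.1)) := fun x =>
    (hmem _ _).1 (e x).2
  have hbool : ∀ i j : Bool, i ≤ j ↔ (i = true → j = true) := by decide
  refine ⟨fun x => (e x).1.1, fun k => e.symm (lo k), fun k => e.symm (hi k),
    e.symm ⟨(a, false), (hmem _ _).2 (Or.inl ⟨rfl, hab⟩)⟩,
    e.symm ⟨(a, true), (hmem _ _).2 (Or.inr ⟨rfl, fun _ => le_rfl⟩)⟩,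
    e.symm ⟨(b, false), (hmem _ _).2 (Or.inl ⟨rfl, le_rfl⟩)⟩,
    e.symm ⟨(b, true), (hmem _ _).2 (Or.inr ⟨rfl, fun _ => hab⟩)⟩, ?_⟩
  constructor
  · intro k x
    simp only [hle, OrderIso.apply_symm_apply, hlo1, hbool, hlo2]
    have := hx x
    refine ⟨fun h => h.1, fun h => ⟨h, fun h' => ?_⟩⟩
    rcases this with h1 | h1
    · exact absurd (h.trans h1.2) h'
    · exact h1.1
  · intro x k
    simp only [hle, OrderIso.apply_symm_apply, hhi1, hbool, hhi2]
    have := hx x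
    refine ⟨fun h => ⟨h, fun h1 h2 => ?_⟩, fun h => h.1⟩
    rcases this with h3 | h3
    · rw [h3.1] at h1
      exact absurd h1 Bool.false_ne_true
    · exact (h3.2 (h.trans h2)).trans h
  · intro k
    simp only [OrderIso.apply_symm_apply, hlo1]
  · intro k
    simp only [OrderIso.apply_symm_apply, hhi1]
  · intro x y hxy
    simp only [hle, OrderIso.apply_symm_apply, hbool]
    beta_reduce at hxy
    rcases hx x with h1 | h1 <;> rcases hx y with h2 | h2
    · simp [hxy, h1.1]
    · simp [hxy, h1.1]
    · have h3 := hxy.trans h2.2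
      simp [h1.1, h2.1, h2.2, h3, h1.2 h3, (h1.2 h3).trans hxy]
    · simp [hxy, h2.1]
  · simp
  · simp
  · intro w h1 h2
    simp only [hle, OrderIso.apply_symm_apply, hbool] at h1 h2 ⊢
    rcases hx w with h3 | h3
    · exact absurd ⟨h3.2, by simp [h3.1]⟩ h2
    · exact ⟨h1.1, fun _ => h3.1⟩
  · intro w h1 h2
    simp only [hle, OrderIso.apply_symm_apply, hbool] at h1 h2 ⊢
    rcases hx w with h3 | h3
    · exact ⟨h1.1, by simp [h3.1]⟩
    · exact absurd ⟨h3.2 h1.1, fun _ => h3.1⟩ h2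
  · simp [hle]
  · simp [hle]
  · simp [hle, hab]
  · simp [hle, hab]
  · simp [hle]

namespace IsDoublingMap

variable {L K : Type u} [Lattice L] [Lattice K] {π : L → K} {σ τ : K → L} {a₀ a₁ b₀ b₁ : L}

protected theorem dual (h : IsDoublingMap π σ τ a₀ a₁ b₀ b₁) :
    IsDoublingMap (L := Lᵒᵈ) (K := Kᵒᵈ) (OrderDual.toDual ∘ π ∘ OrderDual.ofDual)
      (OrderDual.toDual ∘ τ ∘ OrderDual.ofDual) (OrderDual.toDual ∘ σ ∘ OrderDual.ofDual)
      (OrderDual.toDual b₁) (OrderDual.toDual b₀) (OrderDual.toDual a₁) (OrderDual.toDual a₀) where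
  gc_left := h.gc_right.dual
  gc_right := h.gc_left.dual
  map_left := h.map_right
  map_right := h.map_left
  le_or x y hxy := (h.le_or (OrderDual.ofDual y) (OrderDual.ofDual x) hxy).imp id
    fun ⟨h1, h2, h3, h4⟩ => ⟨h4, h3, h2, h1⟩
  map_bot := h.map_top.symm
  map_top := h.map_bot.symm
  le_of_not_le := h.ge_of_not_ge
  ge_of_not_ge := h.le_of_not_le
  bot_le_bot := h.top_le_top
  top_le_top := h.bot_le_bot
  bot_le_top₀ := h.bot_le_top₁
  bot_le_top₁ := h.bot_le_top₀
  not_le := h.not_le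

theorem monotone (h : IsDoublingMap π σ τ a₀ a₁ b₀ b₁) : Monotone π := h.gc_left.monotone_u

theorem map_sup (h : IsDoublingMap π σ τ a₀ a₁ b₀ b₁) (x y : L) : π (x ⊔ y) = π x ⊔ π y :=
  h.gc_right.l_sup

theorem map_inf (h : IsDoublingMap π σ τ a₀ a₁ b₀ b₁) (x y : L) : π (x ⊓ y) = π x ⊓ π y :=
  h.gc_left.u_inf

theorem left_le (h : IsDoublingMap π σ τ a₀ a₁ b₀ b₁) (x : L) : σ (π x) ≤ x :=
  h.gc_left.l_u_le x

theorem left_injective (h : IsDoublingMap π σ τ a₀ a₁ b₀ b₁) : Function.Injective σ :=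
  Function.LeftInverse.injective h.map_left

/-- Distinct comparable elements with the same image are twins. -/
theorem twins_of_lt (h : IsDoublingMap π σ τ a₀ a₁ b₀ b₁) {x y : L} (hxy : x < y)
    (he : π x = π y) : a₁ ≤ y ∧ y ≤ b₁ ∧ a₀ ≤ x ∧ x ≤ b₀ :=
  (h.le_or y x he.ge).resolve_left hxy.not_ge

theorem map_covBy (h : IsDoublingMap π σ τ a₀ a₁ b₀ b₁) {u v : L} (huv : u ⋖ v)
    (hne : π u ≠ π v) : π u ⋖ π v := by
  refine ⟨lt_of_le_of_ne (h.monotone huv.le) hne, fun k huk hkv => ?_⟩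
  have hk : π (u ⊔ σ k) = k := by rw [h.map_sup, h.map_left, sup_eq_right.2 huk.le]
  obtain e | e := huv.eq_or_eq le_sup_left (sup_le huv.le (h.gc_left.l_le hkv.le))
  · rw [e] at hk
    exact huk.ne hk
  · rw [e] at hk
    exact hkv.ne' hk

theorem map_wcovBy (h : IsDoublingMap π σ τ a₀ a₁ b₀ b₁) {u v : L} (huv : u ⋖ v) :
    π u ⩿ π v := by
  by_cases hne : π u = π v
  · exact hne ▸ WCovBy.rfl
  · exact (h.map_covBy huv hne).wcovBy

theorem bot_covBy_bot (h : IsDoublingMap π σ τ a₀ a₁ b₀ b₁) : a₀ ⋖ a₁ := by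
  refine ⟨lt_of_le_of_ne h.bot_le_bot fun e => h.not_le (e ▸ h.bot_le_top₀), fun w h1 h2 => ?_⟩
  have e1 : π a₀ = π w :=
    le_antisymm (h.monotone h1.le) ((h.monotone h2.le).trans h.map_bot.ge)
  have e2 : π w = π a₁ := e1 ▸ h.map_bot
  exact h.not_le ((h.twins_of_lt h1 e1).1.trans (h.twins_of_lt h2 e2).2.2.2)

/-- In a doubling, covers of the original lattice lift. -/
theorem exists_covBy_lift [Finite L] (h : IsDoublingMap π σ τ a₀ a₁ b₀ b₁) {F : Set L}
    (hF : IsMaxChain (· ≤ ·) F) {x y : L} (hx : x ∈ F) (hy : y ∈ F) (hxy : π x ⋖ π y) :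
    ∃ u ∈ F, ∃ v ∈ F, u ⋖ v ∧ π u = π x ∧ π v = π y := by
  obtain ⟨u, hu, v, hv, huv, h1, h2⟩ := hF.exists_covBy_cut (fun f => π f ≤ π x)
    (fun p q hpq hq => (h.monotone hpq).trans hq) hx le_rfl hy hxy.lt.not_ge
  have h3 : π x < π v := lt_of_le_not_ge
    ((hF.1.total hx hv).elim (fun e => h.monotone e) fun e => absurd (h.monotone e) h2) h2
  have h4 : π y ≤ π v := (hF.1.total hy hv).elim (fun e => h.monotone e) fun e =>
    (hxy.eq_or_eq h3.le (h.monotone e)).elim (fun e => absurd e h3.ne') fun e => e.ge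
  have h5 := h.map_wcovBy huv
  refine ⟨u, hu, v, hv, huv, ?_, ?_⟩
  · exact ((h5.eq_or_eq h1 h3.le).resolve_right h3.ne).symm
  · exact ((h5.eq_or_eq (h1.trans hxy.le) h4).resolve_left (h1.trans_lt hxy.lt).ne').symm

theorem isMaxChain_image [Finite L] [BoundedOrder L] (h : IsDoublingMap π σ τ a₀ a₁ b₀ b₁)
    {F : Set L} (hF : IsMaxChain (· ≤ ·) F) : IsMaxChain (· ≤ ·) (π '' F) := by
  refine ⟨h.monotone.isChain_image hF.1, fun T hT hsub => hsub.antisymm fun k hk => ?_⟩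
  have htot : ∀ f ∈ F, π f ≤ k ∨ k ≤ π f := fun f hf =>
    hT.total (hsub (Set.mem_image_of_mem π hf)) hk
  have hbot : π ⊥ ≤ k := by rw [← h.map_left k]; exact h.monotone bot_le
  by_cases htop : π ⊤ ≤ k
  · refine ⟨⊤, hF.top_mem, le_antisymm htop ?_⟩
    rw [← h.map_left k]
    exact h.monotone le_top
  · obtain ⟨u, hu, v, hv, huv, h1, h2⟩ := hF.exists_covBy_cut (fun f => π f ≤ k)
      (fun p q hpq hq => (h.monotone hpq).trans hq) hF.bot_mem hbot hF.top_mem htop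
    have h3 : k ≤ π v := (htot v hv).resolve_left h2
    obtain e | e := (h.map_wcovBy huv).eq_or_eq h1 h3
    · exact ⟨u, hu, e.symm⟩
    · exact absurd e.ge h2

/-- A maximal chain through the lower copy passes to the upper copy along a twin pair. -/
theorem exists_twins_of_lower [Finite L] (h : IsDoublingMap π σ τ a₀ a₁ b₀ b₁) {F : Set L}
    (hF : IsMaxChain (· ≤ ·) F) {x y : L} (hx : x ∈ F) (hax : a₀ ≤ x) (hxb : x ≤ b₀)
    (hy : y ∈ F) (hyb : ¬ y ≤ b₀) : ∃ u ∈ F, ∃ v ∈ F, u ⋖ v ∧ π u = π v := by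
  obtain ⟨u, hu, v, hv, huv, h1, h2⟩ := hF.exists_covBy_cut (fun f => x ⊔ f ≤ b₀)
    (fun p q hpq hq => (sup_le_sup_left hpq x).trans hq) hx (by simpa using hxb) hy
    (fun e => hyb (le_sup_right.trans e))
  have hxv : x ≤ v := (hF.1.total hx hv).elim id fun e => absurd (by simpa [e] using hxb) h2
  rw [sup_eq_right.2 hxv] at h2
  refine ⟨u, hu, v, hv, huv, ?_⟩
  have hxu : x ≤ u := (hF.1.total hx hu).elim id fun e =>
    (huv.eq_or_eq e hxv).elim (fun e => e.le) fun e => absurd (e ▸ hxb) h2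
  rw [sup_eq_right.2 hxu] at h1
  obtain e | e := huv.eq_or_eq (c := u ⊔ a₁) le_sup_left
    (sup_le huv.le (h.le_of_not_le v (hax.trans hxv) h2))
  · exact absurd ((sup_eq_left.1 e).trans h1) h.not_le
  · rw [← e, h.map_sup, ← h.map_bot, ← h.map_sup, sup_eq_left.2 (hax.trans hxu)]

/-- A maximal chain through the upper copy comes from the lower copy along a twin pair. -/
theorem exists_twins_of_upper [Finite L] (h : IsDoublingMap π σ τ a₀ a₁ b₀ b₁) {F : Set L}
    (hF : IsMaxChain (· ≤ ·) F) {x y : L} (hy : y ∈ F) (hay : a₁ ≤ y) (hyb : y ≤ b₁)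
    (hx : x ∈ F) (hax : ¬ a₁ ≤ x) : ∃ u ∈ F, ∃ v ∈ F, u ⋖ v ∧ π u = π v := by
  obtain ⟨v, hv, u, hu, huv, he⟩ := h.dual.exists_twins_of_lower (F := OrderDual.ofDual ⁻¹' F)
    hF.symm (x := OrderDual.toDual y) (y := OrderDual.toDual x) hy hyb hay hx hax
  exact ⟨u, hu, v, hv, huv.ofDual, he.symm⟩

theorem leftModular_map (h : IsDoublingMap π σ τ a₀ a₁ b₀ b₁) {a : L} (ha : LeftModular a) :
    LeftModular (π a) := fun p q hpq => by
  have := congrArg π (ha.eq_of_le (h.gc_left.monotone_l hpq.le))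
  simpa only [h.map_sup, h.map_inf, h.map_left] using this

theorem leftModular_of_map (h : IsDoublingMap π σ τ a₀ a₁ b₀ b₁) {z : L}
    (hz : LeftModular (π z)) (hcases : z ≤ b₀ ∨ a₁ ≤ z) : LeftModular z := fun p q hpq => by
  have hle : p ⊔ (z ⊓ q) ≤ (p ⊔ z) ⊓ q :=
    sup_le (le_inf le_sup_left hpq.le) (inf_le_inf_right q le_sup_right)
  have he : π ((p ⊔ z) ⊓ q) ≤ π (p ⊔ (z ⊓ q)) := by
    simpa only [h.map_sup, h.map_inf] using (hz.eq_of_le (h.monotone hpq.le)).le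
  refine le_antisymm ((h.le_or _ _ he).resolve_right ?_) hle
  rintro ⟨h1, -, -, h4⟩
  rcases hcases with hz0 | hz1
  · exact h.not_le (h1.trans (inf_le_left.trans (sup_le (le_sup_left.trans h4) hz0)))
  · exact h.not_le ((le_inf hz1 (h1.trans inf_le_right)).trans (le_sup_right.trans h4))

/-- A maximal chain of left modular elements contains a twin pair. -/
theorem exists_twins_of_leftModular [Finite L] [BoundedOrder L]
    (h : IsDoublingMap π σ τ a₀ a₁ b₀ b₁) {F : Set L} (hF : IsMaxChain (· ≤ ·) F)
    (hlm : ∀ a ∈ F, LeftModular a) : ∃ u ∈ F, ∃ v ∈ F, u ⋖ v ∧ π u = π v := by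
  obtain ⟨u, hu, v, hv, huv, h1, h2⟩ := hF.exists_covBy_cut (fun f => f ≤ b₀)
    (fun p q hpq hq => hpq.trans hq) hF.bot_mem bot_le hF.top_mem
    (fun e => h.not_le (le_top.trans e))
  have hav : a₁ ≤ v := by
    by_contra hav
    have hmod := (hlm v hv).eq_of_le (h.bot_le_bot.trans h.bot_le_top₁)
    have hl : a₁ ≤ (a₀ ⊔ v) ⊓ b₁ := le_inf
      (h.le_of_not_le _ le_sup_left fun e => h2 (le_sup_right.trans e)) h.bot_le_top₁
    rw [hmod] at hl
    exact h.not_le (hl.trans (sup_le h.bot_le_top₀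
      (h.ge_of_not_ge _ inf_le_right fun e => hav (e.trans inf_le_left))))
  have hau : a₀ ≤ u := by
    obtain e | e := huv.eq_or_eq (c := u ⊔ a₀) le_sup_left
      (sup_le huv.le (h.bot_le_bot.trans hav))
    · exact sup_eq_left.1 e
    · exact absurd (e ▸ sup_le h1 h.bot_le_top₀) h2
  exact h.exists_twins_of_lower hF hu hau h1 hv h2

end IsDoublingMap

end DoublingMaps

section Irreducibles

variable {L K : Type u} [Lattice L] [Lattice K]

theorem isJoinIrred_iff_supIrred [Finite L] {j : L} : IsJoinIrred j ↔ SupIrred j := by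
  constructor
  · rintro ⟨b, hb, huniq⟩
    have hlow : ∀ x, x ⊔ j = j → x ≠ j → x ≤ b := fun x hx hne => by
      obtain ⟨y, hxy, hy⟩ := exists_le_covBy_of_lt (lt_of_le_of_ne (sup_eq_right.1 hx) hne)
      exact hxy.trans (huniq y hy).le
    refine ⟨fun hmin => hb.lt.not_ge (hmin hb.le), fun x y hxy => ?_⟩
    by_contra! hne
    have hx := hlow x (by rw [← hxy]; simp) hne.1
    have hy := hlow y (by rw [← hxy]; simp) hne.2
    exact hb.lt.not_ge (hxy ▸ sup_le hx hy)
  · rintro ⟨hmin, hsup⟩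
    obtain ⟨x, hx⟩ := not_isMin_iff.1 hmin
    obtain ⟨b, -, hb⟩ := exists_le_covBy_of_lt hx
    refine ⟨b, hb, fun c hc => ?_⟩
    by_contra hne
    rcases hsup (WCovBy.sup_eq hc.wcovBy hb.wcovBy hne) with e | e
    · exact hc.ne e
    · exact hb.ne e

theorem isMeetIrred_iff_isJoinIrred_toDual {m : L} :
    IsMeetIrred m ↔ IsJoinIrred (OrderDual.toDual m) :=
  ⟨fun ⟨b, hb, hu⟩ => ⟨OrderDual.toDual b, hb.toDual, fun c hc => hu c hc.ofDual⟩,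
    fun ⟨b, hb, hu⟩ => ⟨OrderDual.ofDual b, hb.ofDual, fun c hc => hu c hc.toDual⟩⟩

theorem ncard_isMeetIrred_eq_dual :
    {m : L | IsMeetIrred m}.ncard = {j : Lᵒᵈ | IsJoinIrred j}.ncard := by
  have : {j : Lᵒᵈ | IsJoinIrred j} = OrderDual.toDual '' {m : L | IsMeetIrred m} := by
    ext j
    constructor
    · exact fun hj => ⟨OrderDual.ofDual j, isMeetIrred_iff_isJoinIrred_toDual.2 hj, rfl⟩
    · rintro ⟨m, hm, rfl⟩
      exact isMeetIrred_iff_isJoinIrred_toDual.1 hm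
  rw [this, Set.ncard_image_of_injective _ OrderDual.toDual.injective]

namespace IsDoublingMap

variable {π : L → K} {σ τ : K → L} {a₀ a₁ b₀ b₁ : L}

theorem supIrred_left_iff (h : IsDoublingMap π σ τ a₀ a₁ b₀ b₁) {k : K} :
    SupIrred (σ k) ↔ SupIrred k := by
  constructor
  · rintro ⟨hmin, hsup⟩
    refine ⟨fun hk => hmin fun x hx => ?_, fun x y hxy => ?_⟩
    · exact h.gc_left.l_le (hk ((h.monotone hx).trans (h.map_left k).le))
    · rw [← hxy, h.gc_left.l_sup] at hsup
      rcases hsup rfl with e | e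
      · exact Or.inl (hxy ▸ h.left_injective (e.trans h.gc_left.l_sup.symm))
      · exact Or.inr (hxy ▸ h.left_injective (e.trans h.gc_left.l_sup.symm))
  · rintro ⟨hmin, hsup⟩
    refine ⟨fun hk => hmin fun x hx => ?_, fun x y hxy => ?_⟩
    · have := h.monotone (hk (h.gc_left.monotone_l hx))
      rwa [h.map_left, h.map_left] at this
    · have hπ : π x ⊔ π y = k := by rw [← h.map_sup, hxy, h.map_left]
      refine (hsup hπ).imp (fun e => ?_) fun e => ?_
      · exact le_antisymm (hxy ▸ le_sup_left) (h.gc_left.l_le e.ge)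
      · exact le_antisymm (hxy ▸ le_sup_right) (h.gc_left.l_le e.ge)

theorem supIrred_bot (h : IsDoublingMap π σ τ a₀ a₁ b₀ b₁) : SupIrred a₁ := by
  refine ⟨fun hmin => h.bot_covBy_bot.lt.not_ge (hmin h.bot_le_bot), fun x y hxy => ?_⟩
  have hlow : ∀ x, x ≤ a₁ → x ≠ a₁ → x ≤ b₀ := fun x hx hne =>
    h.ge_of_not_ge x (hx.trans h.bot_le_top₁) fun e => hne (le_antisymm hx e)
  by_contra! hne
  exact h.not_le (hxy ▸ sup_le (hlow x (hxy ▸ le_sup_left) hne.1)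
    (hlow y (hxy ▸ le_sup_right) hne.2))

theorem eq_of_supIrred (h : IsDoublingMap π σ τ a₀ a₁ b₀ b₁) {j : L} (hj : SupIrred j)
    (hne : σ (π j) ≠ j) : j = a₁ := by
  have htw := h.twins_of_lt (lt_of_le_of_ne (h.left_le j) hne) (h.map_left _)
  have hle : a₁ ⊔ σ (π j) ≤ j := sup_le htw.1 (h.left_le j)
  have hge : j ≤ a₁ ⊔ σ (π j) := by
    refine (h.le_or _ _ ?_).resolve_right fun e => h.not_le (le_sup_left.trans e.2.2.2)
    rw [h.map_sup, h.map_left]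
    exact le_sup_right
  exact ((hj.2 (le_antisymm hle hge)).resolve_right hne).symm

theorem ncard_isJoinIrred [Finite L] [Finite K] (h : IsDoublingMap π σ τ a₀ a₁ b₀ b₁) :
    {j : L | IsJoinIrred j}.ncard = {j : K | IsJoinIrred j}.ncard + 1 := by
  have : {j : L | IsJoinIrred j} = insert a₁ (σ '' {j : K | IsJoinIrred j}) := by
    ext j
    simp only [Set.mem_ofPred_eq, isJoinIrred_iff_supIrred, Set.mem_insert_iff, Set.mem_image]
    constructor
    · intro hj
      by_cases hne : σ (π j) = j
      · exact Or.inr ⟨π j, h.supIrred_left_iff.1 (hne.symm ▸ hj), hne⟩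
      · exact Or.inl (h.eq_of_supIrred hj hne)
    · rintro (rfl | ⟨k, hk, rfl⟩)
      · exact h.supIrred_bot
      · exact h.supIrred_left_iff.2 hk
  rw [this, Set.ncard_insert_of_notMem, Set.ncard_image_of_injective _ h.left_injective]
  rintro ⟨k, -, hk⟩
  refine h.bot_covBy_bot.lt.not_ge (hk ▸ h.gc_left.l_le ?_)
  rw [h.map_bot, ← hk, h.map_left]

theorem ncard_isMeetIrred [Finite L] [Finite K] (h : IsDoublingMap π σ τ a₀ a₁ b₀ b₁) :
    {m : L | IsMeetIrred m}.ncard = {m : K | IsMeetIrred m}.ncard + 1 := by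
  rw [ncard_isMeetIrred_eq_dual, ncard_isMeetIrred_eq_dual, h.dual.ncard_isJoinIrred]

end IsDoublingMap

end Irreducibles

section Labellings

open Classical in
/-- The labelling of a doubling: twin pairs get the new label `n`, all other covers keep the label
of their image. -/
noncomputable def doublingLabel {L K : Type u} (π : L → K) (n : ℕ) (lab : K → K → ℕ) (x y : L) : ℕ :=
  if π x = π y then n else lab (π x) (π y)

theorem doublingLabel_of_eq {L K : Type u} {π : L → K} {n : ℕ} {lab : K → K → ℕ} {x y : L} (h : π x = π y) :
    doublingLabel π n lab x y = n := if_pos h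

theorem doublingLabel_of_ne {L K : Type u} {π : L → K} {n : ℕ} {lab : K → K → ℕ} {x y : L} (h : π x ≠ π y) :
    doublingLabel π n lab x y = lab (π x) (π y) := if_neg h

variable {L K : Type u} [Lattice L] [Lattice K]

/-- The label `i` occurs on some cover relation of the chain `F`. -/
def HasLabel (lab : L → L → ℕ) (F : Set L) (i : ℕ) : Prop :=
  ∃ u ∈ F, ∃ v ∈ F, u ⋖ v ∧ lab u v = i

/-- A labelling of the cover relations of a lattice by `n` labels, modelled on the labelling of a
congruence uniform lattice by the doubling steps that separate the two elements of a cover. -/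
structure IsDoublingLabelling (n : ℕ) (lab : L → L → ℕ) : Prop where
  lab_lt : ∀ u v, u ⋖ v → lab u v < n
  lab_ne : ∀ x y z w, x ⋖ y → y ≤ z → z ⋖ w → lab x y ≠ lab z w
  exists_lab : ∀ i < n, ∃ u v, u ⋖ v ∧ lab u v = i
  hasLabel_left : ∀ F : Set L, IsMaxChain (· ≤ ·) F → ∀ x ∈ F, ∀ y ∈ F, ∀ z, x ⋖ z → z ⋖ y →
    HasLabel lab F (lab x z)
  hasLabel_right : ∀ F : Set L, IsMaxChain (· ≤ ·) F → ∀ x ∈ F, ∀ y ∈ F, ∀ z, x ⋖ z → z ⋖ y →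
    HasLabel lab F (lab z y)
  leftModular_iff : ∀ F : Set L, IsMaxChain (· ≤ ·) F →
    ((∀ a ∈ F, LeftModular a) ↔ ∀ i < n, HasLabel lab F i)
  ncard_join : {j : L | IsJoinIrred j}.ncard = n
  ncard_meet : {m : L | IsMeetIrred m}.ncard = n

theorem isDoublingLabelling_of_subsingleton [Subsingleton L] :
    IsDoublingLabelling (L := L) 0 fun _ _ => 0 where
  lab_lt u v h := absurd (Subsingleton.elim u v) h.ne
  lab_ne x y _ _ h := absurd (Subsingleton.elim x y) h.ne
  exists_lab i hi := absurd hi (Nat.not_lt_zero i)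
  hasLabel_left _ _ x _ _ _ z h := absurd (Subsingleton.elim x z) h.ne
  hasLabel_right _ _ x _ _ _ z h := absurd (Subsingleton.elim x z) h.ne
  leftModular_iff _ _ := ⟨fun _ i hi => absurd hi (Nat.not_lt_zero i),
    fun _ _ _ _ _ _ => Subsingleton.elim _ _⟩
  ncard_join := by
    rw [Set.ncard_eq_zero (Set.toFinite _), Set.eq_empty_iff_forall_notMem]
    rintro j ⟨b, hb, -⟩
    exact hb.ne (Subsingleton.elim _ _)
  ncard_meet := by
    rw [Set.ncard_eq_zero (Set.toFinite _), Set.eq_empty_iff_forall_notMem]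
    rintro j ⟨b, hb, -⟩
    exact hb.ne (Subsingleton.elim _ _)

theorem IsDoublingMap.isDoublingLabelling [Finite L] [BoundedOrder L] [Finite K]
    {π : L → K} {σ τ : K → L} {a₀ a₁ b₀ b₁ : L} (h : IsDoublingMap π σ τ a₀ a₁ b₀ b₁)
    {n : ℕ} {lab : K → K → ℕ} (hK : IsDoublingLabelling n lab) :
    IsDoublingLabelling (n + 1) (doublingLabel π n lab) := by
  have hlt : ∀ {u v : L}, u ⋖ v → π u ≠ π v → doublingLabel π n lab u v < n :=
    fun {u v} huv hne => by
      rw [doublingLabel_of_ne hne]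
      exact hK.lab_lt _ _ (h.map_covBy huv hne)
  have hnew : ∀ {F : Set L}, (∃ u ∈ F, ∃ v ∈ F, u ⋖ v ∧ π u = π v) →
      HasLabel (doublingLabel π n lab) F n := fun {F} ⟨u, hu, v, hv, huv, e⟩ =>
    ⟨u, hu, v, hv, huv, doublingLabel_of_eq e⟩
  have hlift : ∀ {F : Set L}, IsMaxChain (· ≤ ·) F → ∀ {i}, HasLabel lab (π '' F) i →
      HasLabel (doublingLabel π n lab) F i := by
    rintro F hF i ⟨-, ⟨x, hx, rfl⟩, -, ⟨y, hy, rfl⟩, hxy, hi⟩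
    obtain ⟨u, hu, v, hv, huv, e1, e2⟩ := h.exists_covBy_lift hF hx hy hxy
    refine ⟨u, hu, v, hv, huv, ?_⟩
    rw [doublingLabel_of_ne (by rw [e1, e2]; exact hxy.ne), e1, e2, hi]
  have hnot : ∀ {x z y : L}, x < z → z < y → π x = π z → π z ≠ π y :=
    fun hxz hzy e1 e2 => h.not_le ((h.twins_of_lt hxz e1).1.trans (h.twins_of_lt hzy e2).2.2.2)
  refine ⟨fun u v huv => ?_, fun x y z w hxy hyz hzw => ?_, fun i hi => ?_,
    fun F hF x hx y hy z hxz hzy => ?_, fun F hF x hx y hy z hxz hzy => ?_,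
    fun F hF => ⟨fun hlm i hi => ?_, fun hall => ?_⟩, ?_, ?_⟩
  · by_cases e : π u = π v
    · rw [doublingLabel_of_eq e]
      exact Nat.lt_succ_self n
    · exact (hlt huv e).trans (Nat.lt_succ_self n)
  · by_cases e1 : π x = π y <;> by_cases e2 : π z = π w
    · exact absurd ((h.twins_of_lt hxy.lt e1).1.trans
        (hyz.trans (h.twins_of_lt hzw.lt e2).2.2.2)) h.not_le
    · rw [doublingLabel_of_eq e1]
      exact (hlt hzw e2).ne'
    · rw [doublingLabel_of_eq e2]
      exact (hlt hxy e1).ne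
    · rw [doublingLabel_of_ne e1, doublingLabel_of_ne e2]
      exact hK.lab_ne _ _ _ _ (h.map_covBy hxy e1) (h.monotone hyz) (h.map_covBy hzw e2)
  · rcases Nat.lt_succ_iff_lt_or_eq.1 hi with hi | rfl
    · obtain ⟨k, k', hk, hki⟩ := hK.exists_lab i hi
      obtain ⟨F, hF, hsub⟩ := (IsChain.pair (h.gc_left.monotone_l hk.le)).exists_maxChain
      have h1 : σ k ∈ F := hsub (by simp)
      have h2 : σ k' ∈ F := hsub (by simp)
      obtain ⟨u, -, v, -, huv⟩ := hlift hF (i := i)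
        ⟨k, ⟨σ k, h1, h.map_left k⟩, k', ⟨σ k', h2, h.map_left k'⟩, hk, hki⟩
      exact ⟨u, v, huv⟩
    · exact ⟨a₀, a₁, h.bot_covBy_bot, doublingLabel_of_eq h.map_bot⟩
  · by_cases e : π x = π z
    · rw [doublingLabel_of_eq e]
      have htw := h.twins_of_lt hxz.lt e
      exact hnew (h.exists_twins_of_lower hF hx htw.2.2.1 htw.2.2.2 hy
        fun e' => h.not_le (htw.1.trans (hzy.le.trans e')))
    · rw [doublingLabel_of_ne e]
      refine hlift hF ?_
      by_cases e' : π z = π y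
      · exact ⟨π x, ⟨x, hx, rfl⟩, π z, ⟨y, hy, e'.symm⟩, h.map_covBy hxz e, rfl⟩
      · exact hK.hasLabel_left _ (h.isMaxChain_image hF) _ ⟨x, hx, rfl⟩ _ ⟨y, hy, rfl⟩ _
          (h.map_covBy hxz e) (h.map_covBy hzy e')
  · by_cases e : π z = π y
    · rw [doublingLabel_of_eq e]
      have htw := h.twins_of_lt hzy.lt e
      exact hnew (h.exists_twins_of_upper hF hy htw.1 htw.2.1 hx
        fun e' => h.not_le (e'.trans (hxz.le.trans htw.2.2.2)))
    · rw [doublingLabel_of_ne e]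
      refine hlift hF ?_
      by_cases e' : π x = π z
      · exact ⟨π z, ⟨x, hx, e'⟩, π y, ⟨y, hy, rfl⟩, h.map_covBy hzy e, rfl⟩
      · exact hK.hasLabel_right _ (h.isMaxChain_image hF) _ ⟨x, hx, rfl⟩ _ ⟨y, hy, rfl⟩ _
          (h.map_covBy hxz e') (h.map_covBy hzy e)
  · rcases Nat.lt_succ_iff_lt_or_eq.1 hi with hi | rfl
    · refine hlift hF ((hK.leftModular_iff _ (h.isMaxChain_image hF)).1 ?_ i hi)
      rintro - ⟨a, ha, rfl⟩
      exact h.leftModular_map (hlm a ha)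
    · exact hnew (h.exists_twins_of_leftModular hF hlm)
  · obtain ⟨u, hu, v, hv, huv, hn⟩ := hall n (Nat.lt_succ_self n)
    have e : π u = π v := by
      by_contra e
      exact (hlt huv e).ne hn
    have htw := h.twins_of_lt huv.lt e
    have himage : ∀ a ∈ π '' F, LeftModular a := by
      refine (hK.leftModular_iff _ (h.isMaxChain_image hF)).2 fun i hi => ?_
      obtain ⟨x, hx, y, hy, hxy, hl⟩ := hall i (hi.trans (Nat.lt_succ_self n))
      have hne : π x ≠ π y := fun e' => by
        rw [doublingLabel_of_eq e'] at hl
        exact hi.ne' hl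
      rw [doublingLabel_of_ne hne] at hl
      exact ⟨π x, ⟨x, hx, rfl⟩, π y, ⟨y, hy, rfl⟩, h.map_covBy hxy hne, hl⟩
    intro z hz
    refine h.leftModular_of_map (himage _ ⟨z, hz, rfl⟩) ?_
    rcases hF.1.total hz hu with hzu | huz
    · exact Or.inl (hzu.trans htw.2.2.2)
    · rcases hF.1.total hz hv with hzv | hvz
      · rcases huv.eq_or_eq huz hzv with rfl | rfl
        · exact Or.inl htw.2.2.2
        · exact Or.inr htw.1
      · exact Or.inr (htw.1.trans hvz)
  · rw [h.ncard_isJoinIrred, hK.ncard_join]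
  · rw [h.ncard_isMeetIrred, hK.ncard_meet]

theorem IsDoublingOfInterval.exists_isDoublingLabelling (h : IsDoublingOfInterval L K)
    [Finite K] (hK : ∃ (n : ℕ) (lab : K → K → ℕ), IsDoublingLabelling n lab) :
    Finite L ∧ ∃ (n : ℕ) (lab : L → L → ℕ), IsDoublingLabelling n lab := by
  have hfin : Finite L := by
    obtain ⟨a, b, -, ⟨e⟩⟩ := h
    exact Finite.of_equiv _ e.symm.toEquiv
  obtain ⟨π, σ, τ, a₀, a₁, b₀, b₁, hπ⟩ := h.exists_isDoublingMap
  obtain ⟨n, lab, hlab⟩ := hK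
  have : Nonempty L := ⟨a₀⟩
  have := Fintype.ofFinite L
  let _ := Fintype.toBoundedOrder L
  exact ⟨hfin, n + 1, _, hπ.isDoublingLabelling hlab⟩

theorem IsCongruenceUniform.exists_isDoublingLabelling (h : IsCongruenceUniform L) :
    ∃ (n : ℕ) (lab : L → L → ℕ), IsDoublingLabelling n lab := by
  obtain ⟨n, K, inst, ⟨hsub, -⟩, hstep, ⟨e⟩⟩ := h
  have hK : ∀ i, Finite (K i) ∧ ∃ (n : ℕ) (lab : K i → K i → ℕ), IsDoublingLabelling n lab := by
    intro i
    induction i using Fin.induction with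
    | zero => exact ⟨inferInstance, 0, _, isDoublingLabelling_of_subsingleton⟩
    | succ i ih =>
      have := ih.1
      exact (hstep i).exists_isDoublingLabelling ih.2
  cases n with
  | zero =>
    have : Subsingleton (K (Fin.last 0)) := hsub
    have : Subsingleton L := e.injective.subsingleton
    exact ⟨0, _, isDoublingLabelling_of_subsingleton⟩
  | succ n =>
    obtain ⟨a, b, hab, ⟨e'⟩⟩ := hstep (Fin.last n)
    have := (hK (Fin.last n).castSucc).1
    have hL : IsDoublingOfInterval L (K (Fin.last n).castSucc) := ⟨a, b, hab, ⟨e.trans e'⟩⟩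
    exact (hL.exists_isDoublingLabelling (hK _).2).2

end Labellings

theorem IsChain.exists_strictMono {L : Type u} [Lattice L] [Finite L] {F : Set L} (hF : IsChain (· ≤ ·) F) {m : ℕ}
    (hm : F.ncard = m) : ∃ f : Fin m → L, StrictMono f := by
  classical
  let _ : LinearOrder F := hF.linearOrder
  have := Fintype.ofFinite F
  have hcard : Fintype.card F = m := by rw [← hm, ← Nat.card_coe_set_eq, Nat.card_eq_fintype_card]
  let e := Fintype.orderIsoFinOfCardEq F hcard
  exact ⟨fun i => (e i : L), fun i j hij => e.strictMono hij⟩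

section LabelCounting

variable {L : Type u} [Lattice L] {n : ℕ} {lab : L → L → ℕ}

theorem IsDoublingLabelling.hasLabel_subset (hlab : IsDoublingLabelling n lab) (F : Set L) :
    {i | HasLabel lab F i} ⊆ Finset.range n := by
  rintro i ⟨u, -, v, -, huv, rfl⟩
  simpa using hlab.lab_lt u v huv

theorem IsDoublingLabelling.isLeftModularLattice_iff (hlab : IsDoublingLabelling n lab) :
    IsLeftModularLattice L ↔
      ∃ F : Set L, IsMaxChain (· ≤ ·) F ∧ ∀ i < n, HasLabel lab F i := by
  constructor
  · rintro ⟨F, hF, h⟩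
    exact ⟨F, hF, (hlab.leftModular_iff F hF).1 h⟩
  · rintro ⟨F, hF, h⟩
    exact ⟨F, hF, (hlab.leftModular_iff F hF).2 h⟩

variable [BoundedOrder L] [Finite L]

theorem IsDoublingLabelling.ncard_eq (hlab : IsDoublingLabelling n lab) {F : Set L}
    (hF : IsMaxChain (· ≤ ·) F) : F.ncard = {i | HasLabel lab F i}.ncard + 1 := by
  have hex : ∀ v ∈ F, v ≠ ⊥ → ∃ u, u ∈ F ∧ u ⋖ v := fun v hv hne =>
    hF.exists_covBy_left hv hne
  choose! pred hmem hcov using hex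
  have hbelow : ∀ u ∈ F, ∀ v ∈ F, u < v → u ≤ pred v := fun u hu v hv huv => by
    have hne : v ≠ ⊥ := (bot_le.trans_lt huv).ne'
    refine (hF.1.total hu (hmem v hv hne)).elim id fun h => ?_
    exact ((hcov v hv hne).eq_or_eq h huv.le).elim (fun e => e.le) fun e => absurd e huv.ne
  have hinj : Set.InjOn (fun v => lab (pred v) v) (F \ {⊥}) := by
    have hlt : ∀ u ∈ F \ {⊥}, ∀ v ∈ F \ {⊥}, u < v → lab (pred u) u ≠ lab (pred v) v :=
      fun u hu v hv huv => hlab.lab_ne _ _ _ _ (hcov u hu.1 hu.2) (hbelow u hu.1 v hv.1 huv)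
        (hcov v hv.1 hv.2)
    intro u hu v hv huv
    by_contra hne
    rcases hF.1.total hu.1 hv.1 with h | h
    · exact hlt u hu v hv (lt_of_le_of_ne h hne) huv
    · exact hlt v hv u hu (lt_of_le_of_ne h (Ne.symm hne)) huv.symm
  have himage : (fun v => lab (pred v) v) '' (F \ {⊥}) = {i | HasLabel lab F i} := by
    ext i
    constructor
    · rintro ⟨v, hv, rfl⟩
      exact ⟨pred v, hmem v hv.1 hv.2, v, hv.1, hcov v hv.1 hv.2, rfl⟩
    · rintro ⟨u, hu, v, hv, huv, rfl⟩
      have hne : v ≠ ⊥ := (bot_le.trans_lt huv.lt).ne'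
      refine ⟨v, ⟨hv, hne⟩, ?_⟩
      have : pred v = u := (huv.eq_or_eq (hbelow u hu v hv huv.lt)
        (hcov v hv hne).le).resolve_right (hcov v hv hne).ne
      simp only [this]
  rw [← himage, hinj.ncard_image, Set.ncard_sdiff_singleton_add_one hF.bot_mem]

theorem IsDoublingLabelling.ncard_le (hlab : IsDoublingLabelling n lab) {F : Set L}
    (hF : IsMaxChain (· ≤ ·) F) : F.ncard ≤ n + 1 := by
  rw [hlab.ncard_eq hF]
  have := Set.ncard_le_ncard (hlab.hasLabel_subset F) (Finset.finite_toSet _)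
  rw [Set.ncard_coe_finset, Finset.card_range] at this
  omega

theorem IsDoublingLabelling.forall_hasLabel_iff (hlab : IsDoublingLabelling n lab) {F : Set L}
    (hF : IsMaxChain (· ≤ ·) F) : (∀ i < n, HasLabel lab F i) ↔ n + 1 ≤ F.ncard := by
  rw [hlab.ncard_eq hF, Nat.add_le_add_iff_right]
  constructor
  · intro h
    have : {i | HasLabel lab F i} = Finset.range n :=
      (hlab.hasLabel_subset F).antisymm fun i hi => h i (by simpa using hi)
    rw [this, Set.ncard_coe_finset, Finset.card_range]
  · intro h i hi
    have := Set.eq_of_subset_of_ncard_le (hlab.hasLabel_subset F)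
      (by rwa [Set.ncard_coe_finset, Finset.card_range])
    have hi' : i ∈ (Finset.range n : Set ℕ) := by simpa using hi
    rwa [← this] at hi'

theorem IsDoublingLabelling.latLen_eq_iff (hlab : IsDoublingLabelling n lab) :
    latLen L = n ↔ ∃ F : Set L, IsMaxChain (· ≤ ·) F ∧ n + 1 ≤ F.ncard := by
  have hchain : ∀ m (f : Fin (m + 1) → L), StrictMono f →
      ∃ F : Set L, IsMaxChain (· ≤ ·) F ∧ m + 1 ≤ F.ncard := fun m f hf => by
    obtain ⟨F, hF, hsub⟩ := hf.monotone.isChain_range.exists_maxChain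
    refine ⟨F, hF, ?_⟩
    have := Set.ncard_le_ncard hsub (Set.toFinite F)
    rwa [← Set.image_univ, Set.ncard_image_of_injective _ hf.injective, Set.ncard_univ,
      Nat.card_eq_fintype_card, Fintype.card_fin] at this
  have hub : n ∈ upperBounds {m : ℕ | ∃ f : Fin (m + 1) → L, StrictMono f} := by
    rintro m ⟨f, hf⟩
    obtain ⟨F, hF, hle⟩ := hchain m f hf
    have := hlab.ncard_le hF
    omega
  have hne : {m : ℕ | ∃ f : Fin (m + 1) → L, StrictMono f}.Nonempty :=
    ⟨0, fun _ => ⊥, fun i j hij => absurd hij (by omega)⟩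
  constructor
  · intro h
    have hmem := Nat.sSup_mem hne ⟨n, hub⟩
    change latLen L ∈ _ at hmem
    rw [h] at hmem
    obtain ⟨f, hf⟩ := hmem
    exact hchain n f hf
  · rintro ⟨F, hF, hle⟩
    refine le_antisymm (csSup_le hne hub) (le_csSup ⟨n, hub⟩ ?_)
    exact hF.1.exists_strictMono (le_antisymm (hlab.ncard_le hF) hle)

theorem IsDoublingLabelling.isExtremal_iff (hlab : IsDoublingLabelling n lab) :
    IsExtremal L ↔ IsLeftModularLattice L := by
  unfold IsExtremal
  rw [hlab.ncard_join, hlab.ncard_meet, and_self, hlab.latLen_eq_iff,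
    hlab.isLeftModularLattice_iff]
  exact exists_congr fun F => and_congr_right fun hF => (hlab.forall_hasLabel_iff hF).symm

/-- Exchanging a single element of a maximal chain does not lose labels. -/
theorem IsDoublingLabelling.hasLabel_of_exchange (hlab : IsDoublingLabelling n lab)
    {F G : Set L} (hF : IsMaxChain (· ≤ ·) F) (hG : IsMaxChain (· ≤ ·) G) {z : L}
    (hz : z ∉ F) (hsub : ∀ g ∈ G, g ≠ z → g ∈ F) {i : ℕ} (hi : HasLabel lab G i) :
    HasLabel lab F i := by
  obtain ⟨u, hu, v, hv, huv, rfl⟩ := hi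
  by_cases huz : u = z
  · subst huz
    obtain ⟨x, hx, hxu⟩ := hG.exists_covBy_left hu fun e => hz (e ▸ hF.bot_mem)
    exact hlab.hasLabel_right F hF x (hsub x hx hxu.ne) v (hsub v hv huv.ne') u hxu huv
  · by_cases hvz : v = z
    · subst hvz
      obtain ⟨y, hy, hvy⟩ := hG.exists_covBy_right hv fun e => hz (e ▸ hF.top_mem)
      exact hlab.hasLabel_left F hF u (hsub u hu huv.ne) y (hsub y hy hvy.ne') v huv hvy
    · exact ⟨u, hsub u hu huz, v, hsub v hv hvz, huv, rfl⟩

theorem IsDoublingLabelling.isLeftModularLattice_of_isShellable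
    (hlab : IsDoublingLabelling n lab) (h : IsShellable L) : IsLeftModularLattice L := by
  classical
  obtain ⟨k, F, -, hmax, hshell⟩ := h
  have hF : ∀ j, IsMaxChain (· ≤ ·) (F j : Set L) := fun j => (hmax _).2 ⟨j, rfl⟩
  obtain ⟨M, hM, -⟩ := (IsChain.empty (r := (· ≤ ·)) (α := L)).exists_maxChain
  obtain ⟨i₀, -⟩ := (hmax M).1 hM
  have hk : 0 < k := i₀.pos
  have hlabels : ∀ j i, HasLabel lab (F j : Set L) i →
      HasLabel lab (F ⟨0, hk⟩ : Set L) i := by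
    intro j
    induction j using WellFoundedLT.induction with
    | ind j ih =>
      intro i hi
      by_cases hj : j = ⟨0, hk⟩
      · rwa [hj] at hi
      · have hpos : (⟨0, hk⟩ : Fin k) < j :=
          lt_of_le_of_ne (Fin.mk_le_of_le_val (Nat.zero_le _)) (Ne.symm hj)
        obtain ⟨l, hl, -, hcard⟩ := hshell _ j hpos
        have hjpos : 0 < (F j).card := Finset.card_pos.2 ⟨⊥, (hF j).bot_mem⟩
        have hdiff : (F j \ F l).card = 1 := by
          have := Finset.card_sdiff_add_card_inter (F j) (F l)
          rw [Finset.inter_comm] at this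
          omega
        obtain ⟨z, hz⟩ := Finset.card_eq_one.1 hdiff
        have hzl : z ∉ F l := (Finset.mem_sdiff.1 (hz ▸ Finset.mem_singleton_self z)).2
        refine ih l hl i (hlab.hasLabel_of_exchange (hF l) (hF j) hzl (fun g hg hgz => ?_) hi)
        by_contra hgl
        have : g ∈ F j \ F l := Finset.mem_sdiff.2 ⟨hg, hgl⟩
        rw [hz, Finset.mem_singleton] at this
        exact hgz this
  refine hlab.isLeftModularLattice_iff.2 ⟨_, hF ⟨0, hk⟩, fun i hi => ?_⟩
  obtain ⟨u, v, huv, hi⟩ := hlab.exists_lab i hi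
  obtain ⟨G, hG, hsub⟩ := (IsChain.pair huv.le).exists_maxChain
  obtain ⟨j, rfl⟩ := (hmax G).1 hG
  exact hlabels j i ⟨u, hsub (by simp), v, hsub (by simp), huv, hi⟩

end LabelCounting


/-- For a congruence uniform lattice, being extremal, being left modular, and being
shellable are all equivalent. -/
theorem congruenceUniform_extremal_leftModular_shellable_tfae (α : Type u)
    [Lattice α] [Fintype α] [Nonempty α] (hcu : IsCongruenceUniform α) :
    (IsExtremal α ↔ IsLeftModularLattice α) ∧
    (IsLeftModularLattice α ↔ IsShellable α) := by
  let _ := Fintype.toBoundedOrder α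
  obtain ⟨n, lab, hlab⟩ := hcu.exists_isDoublingLabelling
  exact ⟨hlab.isExtremal_iff,
    IsLeftModularLattice.isShellable, hlab.isLeftModularLattice_of_isShellable⟩
end

section
/- Let L be a finite lattice and C a nonempty convex subset of L that does not intersect the spine of L. Then the facet adjacency graph FA(L[C]) of the doubling L[C] contains two disjoint source sets; explicitly, the set of maximal chains of L[C] that contain both (c,0) and (c,1) for some c ∈ C, and the set of chains of L[C] of the form (G,0) where G is a chain of L of length ℓ(L) (with every element tagged according to whether or not it lies in I_L(C)), are two disjoint source sets of FA(L[C]). -/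
universe u

open Classical in
/-- Tagging of an element `x` of `L` in the doubling `L[C]`: `x` is sent to `(x, 0)` if
`x ∈ I_L(C)` and to `(x, 1)` otherwise. -/
noncomputable def tag {α : Type u} [Preorder α] (C : Set α) (x : α) : Doubling C :=
  if h : x ∈ lowerIdeal C then ⟨(x, false), Or.inl ⟨rfl, h⟩⟩
  else ⟨(x, true), Or.inr ⟨rfl, Or.inl h⟩⟩

/-- The vertex set of the facet adjacency graph `FA(L)`: the maximal chains of `L`,
viewed as finite sets. -/
def MaxChainSet (β : Type u) [Preorder β] : Set (Finset β) :=
  {s : Finset β | IsMaxChain (· ≤ ·) (↑s : Set β)}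

open Classical in
/-- The edge relation of the facet adjacency graph `FA(L)`: `F → G` iff
`|F ∩ G| = |G| - 1`. -/
def FAEdge (β : Type u) [Preorder β] (F G : Finset β) : Prop :=
  (F ∩ G).card = G.card - 1

/-- A source set of `FA(L)`: a nonempty proper subset `X` of the set of maximal chains
such that no edge `F → G` of `FA(L)` has `F ∉ X` and `G ∈ X`. -/
def IsSourceSet (β : Type u) [Preorder β] (X : Set (Finset β)) : Prop :=
  X.Nonempty ∧ X ⊂ MaxChainSet β ∧
    ∀ F ∈ MaxChainSet β, F ∉ X → ∀ G ∈ X, ¬ FAEdge β F G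

/-! ### Chains of maximum length -/

section Length

variable {β : Type u} [PartialOrder β]

/-- A chain with `n` elements is the range of a strictly increasing map from `Fin n`. -/
theorem exists_strictMono_range_eq_of_isChain {G : Finset β}
    (hG : IsChain (· ≤ ·) (G : Set β)) {n : ℕ} (hn : G.card = n) :
    ∃ f : Fin n → β, StrictMono f ∧ Set.range f = G := by
  classical
  let _ : LinearOrder G :=
    { (inferInstance : PartialOrder G) with
      le_total := fun a b => hG.total a.2 b.2
      toDecidableLE := Classical.decRel _ }
  have e : Fin n ≃o G := Fintype.orderIsoFinOfCardEq G (by simpa using hn)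
  refine ⟨fun i => (e i : β), fun i j hij => e.strictMono hij, ?_⟩
  ext x
  constructor
  · rintro ⟨i, rfl⟩
    exact (e i).2
  · intro hx
    exact ⟨e.symm ⟨x, hx⟩, by simp⟩

theorem bddAbove_setOf_strictMono_fin [Fintype β] :
    BddAbove {n : ℕ | ∃ f : Fin (n + 1) → β, StrictMono f} := by
  refine ⟨Fintype.card β, ?_⟩
  rintro n ⟨f, hf⟩
  have := Fintype.card_le_of_injective f hf.injective
  simp only [Fintype.card_fin] at this
  omega

theorem card_le_latLen_add_one [Fintype β] {G : Finset β}
    (hG : IsChain (· ≤ ·) (G : Set β)) : G.card ≤ latLen β + 1 := by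
  rcases Nat.eq_zero_or_pos G.card with h | h
  · omega
  · obtain ⟨f, hf, -⟩ :=
      exists_strictMono_range_eq_of_isChain hG (n := G.card - 1 + 1) (by omega)
    have : G.card - 1 ≤ latLen β := le_csSup bddAbove_setOf_strictMono_fin ⟨f, hf⟩
    omega

theorem mem_spine_of_card_eq {G : Finset β} (hG : IsChain (· ≤ ·) (G : Set β))
    (hcard : G.card = latLen β + 1) {x : β} (hx : x ∈ G) : x ∈ spine β := by
  obtain ⟨f, hf, hr⟩ := exists_strictMono_range_eq_of_isChain hG hcard
  exact ⟨f, hf, hr ▸ hx⟩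

theorem exists_isChain_card_eq_latLen_add_one [Fintype β] [Nonempty β] :
    ∃ G : Finset β, IsChain (· ≤ ·) (G : Set β) ∧ G.card = latLen β + 1 := by
  have hne : {n : ℕ | ∃ f : Fin (n + 1) → β, StrictMono f}.Nonempty :=
    ⟨0, fun _ => Classical.arbitrary β, fun i j hij => by omega⟩
  obtain ⟨f, hf⟩ := Nat.sSup_mem hne bddAbove_setOf_strictMono_fin
  refine ⟨Finset.univ.map ⟨f, hf.injective⟩, ?_, ?_⟩
  · simpa using hf.monotone.isChain_range
  · simp [latLen]

/-- An element comparable to every member of a chain of maximum length belongs to it. -/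
theorem mem_of_forall_comparable_of_card_eq [Fintype β] {G : Finset β}
    (hG : IsChain (· ≤ ·) (G : Set β)) (hcard : G.card = latLen β + 1) {z : β}
    (hz : ∀ x ∈ G, z ≤ x ∨ x ≤ z) : z ∈ G := by
  classical
  by_contra hzG
  have hchain : IsChain (· ≤ ·) ((insert z G : Finset β) : Set β) := by
    rw [Finset.coe_insert]
    exact hG.insert fun x hx _ => hz x hx
  have := card_le_latLen_add_one hchain
  rw [Finset.card_insert_of_notMem hzG] at this
  omega

end Length

/-! ### Maximal chains and edges of the facet adjacency graph -/

section MaxChain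

variable {β : Type u} [Preorder β]

theorem mem_of_forall_comparable_of_mem_maxChainSet {F : Finset β} (hF : F ∈ MaxChainSet β)
    {z : β} (hz : ∀ x ∈ F, z ≤ x ∨ x ≤ z) : z ∈ F := by
  have := hF.2 (hF.1.insert fun x hx _ => hz x hx) (Set.subset_insert z _)
  exact Finset.mem_coe.1 (this ▸ Set.mem_insert z _)

theorem eq_of_subset_of_mem_maxChainSet {F G : Finset β} (hF : F ∈ MaxChainSet β)
    (hG : G ∈ MaxChainSet β) (h : F ⊆ G) : F = G :=
  Finset.coe_injective (hF.2 hG.1 (Finset.coe_subset.2 h))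

theorem mem_maxChainSet_of_forall_comparable {F : Finset β} (hF : IsChain (· ≤ ·) (F : Set β))
    (h : ∀ z, (∀ x ∈ F, z ≤ x ∨ x ≤ z) → z ∈ F) : F ∈ MaxChainSet β := by
  refine ⟨hF, fun t ht hFt => hFt.antisymm fun z hz => h z fun x hx => ?_⟩
  exact ht.total hz (hFt hx)

/-- If `F → G` is an edge and `G` is nonempty, then `F` misses exactly one element of `G`. -/
theorem FAEdge.exists_notMem {F G : Finset β} (h : FAEdge β F G) (hG : G.Nonempty) :
    ∃ x ∈ G, x ∉ F ∧ ∀ y ∈ G, y ≠ x → y ∈ F := by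
  classical
  have hpos := hG.card_pos
  have hcard : (G \ F).card = 1 := by
    have h1 := Finset.card_sdiff_add_card_inter G F
    have h2 : (F ∩ G).card = G.card - 1 := by unfold FAEdge at h; convert h
    rw [Finset.inter_comm] at h2
    omega
  obtain ⟨x, hx⟩ := Finset.card_eq_one.1 hcard
  have hmem : ∀ y, y ∈ G ∧ y ∉ F ↔ y = x := fun y => by
    rw [← Finset.mem_sdiff, hx, Finset.mem_singleton]
  refine ⟨x, ((hmem x).2 rfl).1, ((hmem x).2 rfl).2, fun y hy hyx => ?_⟩
  by_contra hyF
  exact hyx ((hmem y).1 ⟨hy, hyF⟩)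

end MaxChain

/-! ### The doubling -/

section Doubling

variable {α : Type u}

section Preorder

variable [Preorder α] {C : Set α}

theorem subset_lowerIdeal : C ⊆ lowerIdeal C := fun x hx => ⟨x, hx, le_rfl⟩

theorem isLowerSet_lowerIdeal : IsLowerSet (lowerIdeal C) :=
  fun _ _ hba ⟨x, hx, hax⟩ => ⟨x, hx, hba.trans hax⟩

theorem tag_fst (x : α) : (tag C x).1.1 = x := by
  unfold tag
  split_ifs <;> rfl

theorem tag_injective : Function.Injective (tag C) := fun x y h => by
  rw [← tag_fst (C := C) x, h, tag_fst]

theorem tag_monotone : Monotone (tag C) := fun x y hxy => by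
  unfold tag
  split_ifs with hx hy hy
  · exact ⟨hxy, le_rfl⟩
  · exact ⟨hxy, Bool.false_le _⟩
  · exact absurd (isLowerSet_lowerIdeal hxy hy) hx
  · exact ⟨hxy, le_rfl⟩

theorem Doubling.mem_lowerIdeal_of_snd_eq_false {u : Doubling C} (h : u.1.2 = false) :
    u.1.1 ∈ lowerIdeal C := by
  rcases u.2 with ⟨_, hu⟩ | ⟨hu, _⟩
  · exact hu
  · simp [h] at hu

theorem Doubling.mem_of_snd_eq_true {u : Doubling C} (h : u.1.2 = true)
    (hI : u.1.1 ∈ lowerIdeal C) : u.1.1 ∈ C := by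
  rcases u.2 with ⟨hu, _⟩ | ⟨_, hu | hu⟩
  · simp [h] at hu
  · exact absurd hI hu
  · exact hu

theorem tag_fst_eq_self {u : Doubling C} (h : u.1.1 ∉ C) : tag C u.1.1 = u := by
  apply Subtype.ext
  rcases hb : u.1.2 with _ | _
  · have hI := u.mem_lowerIdeal_of_snd_eq_false hb
    simp only [tag, hI, dite_true]
    exact Prod.ext rfl hb.symm
  · have hI : u.1.1 ∉ lowerIdeal C := fun hI => h (u.mem_of_snd_eq_true hb hI)
    simp only [tag, hI, dite_false]
    exact Prod.ext rfl hb.symm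

/-- The lower copy `(c, 0)` of an element `c ∈ C`. -/
def lowerCopy (c : α) (hc : c ∈ C) : Doubling C :=
  ⟨(c, false), Or.inl ⟨rfl, subset_lowerIdeal hc⟩⟩

/-- The upper copy `(c, 1)` of an element `c ∈ C`. -/
def upperCopy (c : α) (hc : c ∈ C) : Doubling C :=
  ⟨(c, true), Or.inr ⟨rfl, Or.inr hc⟩⟩

theorem lowerCopy_le_iff {c : α} {hc : c ∈ C} {u : Doubling C} :
    lowerCopy c hc ≤ u ↔ c ≤ u.1.1 :=
  ⟨fun h => h.1, fun h => ⟨h, Bool.false_le _⟩⟩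

theorem le_upperCopy_iff {c : α} {hc : c ∈ C} {u : Doubling C} :
    u ≤ upperCopy c hc ↔ u.1.1 ≤ c :=
  ⟨fun h => h.1, fun h => ⟨h, Bool.le_true _⟩⟩

theorem le_lowerCopy_iff {c : α} {hc : c ∈ C} {u : Doubling C} :
    u ≤ lowerCopy c hc ↔ u.1.1 ≤ c ∧ u.1.2 = false :=
  and_congr_right fun _ => le_bot_iff (α := Bool)

theorem upperCopy_le_iff {c : α} {hc : c ∈ C} {u : Doubling C} :
    upperCopy c hc ≤ u ↔ c ≤ u.1.1 ∧ u.1.2 = true :=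
  and_congr_right fun _ => top_le_iff (α := Bool)

theorem lowerCopy_le_upperCopy {c : α} (hc : c ∈ C) : lowerCopy c hc ≤ upperCopy c hc :=
  lowerCopy_le_iff.2 le_rfl

theorem lowerCopy_ne_upperCopy {b c : α} (hb : b ∈ C) (hc : c ∈ C) :
    lowerCopy b hb ≠ upperCopy c hc := fun h => by
  simpa [lowerCopy, upperCopy] using congrArg (fun u : Doubling C => u.1.2) h

end Preorder

section PartialOrder

variable [PartialOrder α] {C : Set α}

/-- A maximal chain of `L[C]` that contains `(c, 1)` together with all elements except `(c, 0)`
of a maximal chain through `(c, 0)` and `(c, 1)`, but not `(c, 0)` itself, contains both copies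
of some element of `C`. -/
theorem exists_copies_mem_of_lowerCopy_notMem {F G : Finset (Doubling C)}
    (hF : F ∈ MaxChainSet (Doubling C)) (hG : G ∈ MaxChainSet (Doubling C))
    {c : α} (hc : c ∈ C) (hlow : lowerCopy c hc ∈ G) (hup : upperCopy c hc ∈ F)
    (hnot : lowerCopy c hc ∉ F) (hsub : ∀ y ∈ G, y ≠ lowerCopy c hc → y ∈ F) :
    ∃ z, ∃ hz : z ∈ C, lowerCopy z hz ∈ F ∧ upperCopy z hz ∈ F := by
  obtain ⟨u, huF, hu⟩ : ∃ u ∈ F, ¬ (lowerCopy c hc ≤ u ∨ u ≤ lowerCopy c hc) := by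
    by_contra! h
    exact hnot (mem_of_forall_comparable_of_mem_maxChainSet hF h)
  rw [not_or, lowerCopy_le_iff, le_lowerCopy_iff, not_and, Bool.not_eq_false] at hu
  have huc : u.1.1 ≤ c := by
    rcases hF.1.total huF hup with h | h
    · exact le_upperCopy_iff.1 h
    · exact absurd (upperCopy_le_iff.1 h).1 hu.1
  have hut := hu.2 huc
  have huC : u.1.1 ∈ C := u.mem_of_snd_eq_true hut ⟨c, hc, huc⟩
  have hupu : upperCopy u.1.1 huC = u := Subtype.ext (Prod.ext rfl hut.symm)
  refine ⟨u.1.1, huC, ?_, hupu.symm ▸ huF⟩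
  refine hsub _ (mem_of_forall_comparable_of_mem_maxChainSet hG fun x hx => ?_) fun h =>
    hu.1 (congrArg (fun v : Doubling C => v.1.1) h).ge
  rw [lowerCopy_le_iff, le_lowerCopy_iff]
  by_cases hxc : x = lowerCopy c hc
  · exact Or.inl (hxc ▸ huc)
  rcases hF.1.total huF (hsub x hx hxc) with h | h
  · exact Or.inl h.1
  · refine Or.inr ⟨h.1, ?_⟩
    rcases hG.1.total hlow hx with h' | h'
    · exact absurd ((lowerCopy_le_iff.1 h').trans h.1) hu.1
    · exact (le_lowerCopy_iff.1 h').2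

/-- A maximal chain of `L[C]` that contains `(c, 0)` together with all elements except `(c, 1)`
of a maximal chain through `(c, 0)` and `(c, 1)`, but not `(c, 1)` itself, contains both copies
of some element of `C`. -/
theorem exists_copies_mem_of_upperCopy_notMem (hconv : C.OrdConnected)
    {F G : Finset (Doubling C)}
    (hF : F ∈ MaxChainSet (Doubling C)) (hG : G ∈ MaxChainSet (Doubling C))
    {c : α} (hc : c ∈ C) (hup : upperCopy c hc ∈ G) (hlow : lowerCopy c hc ∈ F)
    (hnot : upperCopy c hc ∉ F) (hsub : ∀ y ∈ G, y ≠ upperCopy c hc → y ∈ F) :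
    ∃ z, ∃ hz : z ∈ C, lowerCopy z hz ∈ F ∧ upperCopy z hz ∈ F := by
  obtain ⟨u, huF, hu⟩ : ∃ u ∈ F, ¬ (u ≤ upperCopy c hc ∨ upperCopy c hc ≤ u) := by
    by_contra! h
    exact hnot (mem_of_forall_comparable_of_mem_maxChainSet hF fun x hx =>
      (h x hx).symm)
  rw [not_or, le_upperCopy_iff, upperCopy_le_iff, not_and, Bool.not_eq_true] at hu
  have hcu : c ≤ u.1.1 := by
    rcases hF.1.total hlow huF with h | h
    · exact lowerCopy_le_iff.1 h
    · exact absurd (le_lowerCopy_iff.1 h).1 hu.1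
  have huf := hu.2 hcu
  have huC : u.1.1 ∈ C := by
    obtain ⟨d, hd, hud⟩ := u.mem_lowerIdeal_of_snd_eq_false huf
    exact hconv.out hc hd ⟨hcu, hud⟩
  have hlowu : lowerCopy u.1.1 huC = u := Subtype.ext (Prod.ext rfl huf.symm)
  refine ⟨u.1.1, huC, hlowu.symm ▸ huF, ?_⟩
  refine hsub _ (mem_of_forall_comparable_of_mem_maxChainSet hG fun x hx => ?_) fun h =>
    hu.1 (congrArg (fun v : Doubling C => v.1.1) h).le
  rw [le_upperCopy_iff, upperCopy_le_iff]
  by_cases hxc : x = upperCopy c hc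
  · exact Or.inr (hxc ▸ hcu)
  rcases hF.1.total huF (hsub x hx hxc) with h | h
  · refine Or.inl ⟨h.1, ?_⟩
    rcases hG.1.total hup hx with h' | h'
    · exact (upperCopy_le_iff.1 h').2
    · exact absurd (h.1.trans (le_upperCopy_iff.1 h')) hu.1
  · exact Or.inr h.1

theorem exists_maxChain_copies_mem [Fintype α] {c : α} (hc : c ∈ C) :
    ∃ s ∈ MaxChainSet (Doubling C), lowerCopy c hc ∈ s ∧ upperCopy c hc ∈ s := by
  have hpair : IsChain (· ≤ ·) {lowerCopy c hc, upperCopy c hc} :=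
    IsChain.pair (lowerCopy_le_upperCopy hc)
  obtain ⟨t, ht, hsub⟩ := hpair.exists_maxChain
  refine ⟨t.toFinite.toFinset, ?_, ?_, ?_⟩
  · simpa [MaxChainSet] using ht
  · simpa using hsub (Set.mem_insert _ _)
  · simpa using hsub (Set.mem_insert_of_mem _ rfl)

theorem notMem_of_mem_of_card_eq (hspine : C ∩ spine α = ∅) {G : Finset α}
    (hG : IsChain (· ≤ ·) (G : Set α)) (hcard : G.card = latLen α + 1) {x : α} (hx : x ∈ G) :
    x ∉ C := fun hxC =>
  Set.eq_empty_iff_forall_notMem.1 hspine x ⟨hxC, mem_spine_of_card_eq hG hcard hx⟩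

open Classical in
theorem image_tag_mem_maxChainSet [Fintype α] (hspine : C ∩ spine α = ∅) {G : Finset α}
    (hG : IsChain (· ≤ ·) (G : Set α)) (hcard : G.card = latLen α + 1) :
    G.image (tag C) ∈ MaxChainSet (Doubling C) := by
  refine mem_maxChainSet_of_forall_comparable ?_ fun u hu => ?_
  · intro x hx y hy _
    obtain ⟨a, ha, rfl⟩ := Finset.mem_image.1 (Finset.mem_coe.1 hx)
    obtain ⟨b, hb, rfl⟩ := Finset.mem_image.1 (Finset.mem_coe.1 hy)
    exact (hG.total ha hb).imp (fun h => tag_monotone h) (fun h => tag_monotone h)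
  · have huG : u.1.1 ∈ G := mem_of_forall_comparable_of_card_eq hG hcard fun x hx =>
      (hu _ (Finset.mem_image_of_mem _ hx)).imp
        (fun h => (h.1.trans_eq (tag_fst x))) (fun h => ((tag_fst x).ge.trans h.1))
    exact Finset.mem_image.2
      ⟨_, huG, tag_fst_eq_self (notMem_of_mem_of_card_eq hspine hG hcard huG)⟩

open Classical in
/-- A maximal chain of `L[C]` with an edge to `(G, 0)`, where `G` has maximum length, is itself
of the form `(G', 0)` for some `G'` of maximum length. -/
theorem exists_eq_image_tag_of_faEdge [Fintype α] (hspine : C ∩ spine α = ∅) {G : Finset α}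
    (hG : IsChain (· ≤ ·) (G : Set α)) (hcard : G.card = latLen α + 1)
    {F : Finset (Doubling C)} (hF : F ∈ MaxChainSet (Doubling C))
    (hedge : FAEdge (Doubling C) F (G.image (tag C))) :
    ∃ G' : Finset α, IsChain (· ≤ ·) (G' : Set α) ∧ G'.card = latLen α + 1 ∧
      F = G'.image (tag C) := by
  have hGne : G.Nonempty := Finset.card_pos.1 (by omega)
  obtain ⟨_, hxG, hxF, hsub⟩ := hedge.exists_notMem (hGne.image _)
  obtain ⟨x, hx, rfl⟩ := Finset.mem_image.1 hxG
  have hmax := image_tag_mem_maxChainSet hspine hG hcard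
  obtain ⟨u, huF, hu⟩ : ∃ u ∈ F, u ∉ G.image (tag C) := by
    by_contra! h
    exact hxF (eq_of_subset_of_mem_maxChainSet hF hmax h ▸ hxG)
  have huG : u.1.1 ∉ G := fun h => hu (Finset.mem_image.2
    ⟨_, h, tag_fst_eq_self (notMem_of_mem_of_card_eq hspine hG hcard h)⟩)
  have herase : ∀ y ∈ G.erase x, tag C y ∈ F := fun y hy =>
    hsub _ (Finset.mem_image_of_mem _ (Finset.mem_of_mem_erase hy))
      (tag_injective.ne (Finset.ne_of_mem_erase hy))
  have hchain : IsChain (· ≤ ·) ((insert u.1.1 (G.erase x) : Finset α) : Set α) := by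
    rw [Finset.coe_insert]
    refine (hG.mono (Finset.coe_subset.2 (Finset.erase_subset x G))).insert fun y hy _ => ?_
    exact (hF.1.total huF (herase y hy)).imp
      (fun h => h.1.trans_eq (tag_fst y)) (fun h => (tag_fst y).ge.trans h.1)
  have hcard' : (insert u.1.1 (G.erase x)).card = latLen α + 1 := by
    rw [Finset.card_insert_of_notMem fun h => huG (Finset.mem_of_mem_erase h),
      Finset.card_erase_of_mem hx, hcard]
    rfl
  refine ⟨_, hchain, hcard', Eq.symm ?_⟩
  refine eq_of_subset_of_mem_maxChainSet (image_tag_mem_maxChainSet hspine hchain hcard') hF ?_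
  intro v hv
  obtain ⟨y, hy, rfl⟩ := Finset.mem_image.1 hv
  rcases Finset.mem_insert.1 hy with rfl | hy
  · rwa [tag_fst_eq_self
      (notMem_of_mem_of_card_eq hspine hchain hcard' (Finset.mem_insert_self _ _))]
  · exact herase y hy

end PartialOrder

end Doubling

open Classical in
/-- If a nonempty convex subset `C` of a finite lattice `L` does not intersect the spine
of `L`, then the set of maximal chains of `L[C]` containing both `(c,0)` and `(c,1)` for
some `c ∈ C`, and the set of chains of `L[C]` of the form `(G,0)` for `G` a chain of `L`
of length `ℓ(L)` (every element tagged according to whether it lies in `I_L(C)`), are two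
disjoint source sets of the facet adjacency graph `FA(L[C])`. -/
theorem doubling_outside_spine_two_disjoint_sourceSets (α : Type u)
    [Lattice α] [Fintype α] [Nonempty α]
    (C : Set α) (hne : C.Nonempty) (hconv : C.OrdConnected)
    (hspine : C ∩ spine α = ∅) :
    IsSourceSet (Doubling C)
      {s : Finset (Doubling C) | s ∈ MaxChainSet (Doubling C) ∧
        ∃ c ∈ C, (∃ u ∈ s, u.1 = ((c, false) : α × Bool)) ∧
          (∃ v ∈ s, v.1 = ((c, true) : α × Bool))} ∧
    IsSourceSet (Doubling C)
      {s : Finset (Doubling C) | ∃ G : Finset α,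
        IsChain (· ≤ ·) (↑G : Set α) ∧ G.card = latLen α + 1 ∧ s = G.image (tag C)} ∧
    {s : Finset (Doubling C) | s ∈ MaxChainSet (Doubling C) ∧
        ∃ c ∈ C, (∃ u ∈ s, u.1 = ((c, false) : α × Bool)) ∧
          (∃ v ∈ s, v.1 = ((c, true) : α × Bool))} ∩
      {s : Finset (Doubling C) | ∃ G : Finset α,
        IsChain (· ≤ ·) (↑G : Set α) ∧ G.card = latLen α + 1 ∧ s = G.image (tag C)} = ∅ := by
  have hdisj : ∀ s : Finset (Doubling C),
      (∃ c ∈ C, (∃ u ∈ s, u.1 = ((c, false) : α × Bool)) ∧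
        (∃ v ∈ s, v.1 = ((c, true) : α × Bool))) →
      ¬ ∃ G : Finset α, IsChain (· ≤ ·) (↑G : Set α) ∧ G.card = latLen α + 1 ∧
        s = G.image (tag C) := by
    rintro s ⟨c, hc, ⟨u, hu, huc⟩, -⟩ ⟨G, hG, hcard, rfl⟩
    obtain ⟨x, hx, rfl⟩ := Finset.mem_image.1 hu
    have hxc : x = c := by rw [← tag_fst (C := C) x, huc]
    exact notMem_of_mem_of_card_eq hspine hG hcard hx (hxc ▸ hc)
  obtain ⟨c₀, hc₀⟩ := hne
  obtain ⟨s, hs, hlow, hup⟩ := exists_maxChain_copies_mem hc₀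
  have hs' : ∃ c ∈ C, (∃ u ∈ s, u.1 = ((c, false) : α × Bool)) ∧
      (∃ v ∈ s, v.1 = ((c, true) : α × Bool)) :=
    ⟨c₀, hc₀, ⟨_, hlow, rfl⟩, ⟨_, hup, rfl⟩⟩
  obtain ⟨G₀, hG₀, hcard₀⟩ := exists_isChain_card_eq_latLen_add_one (β := α)
  refine ⟨⟨⟨s, hs, hs'⟩, ⟨fun t ht => ht.1, fun h => ?_⟩, ?_⟩,
    ⟨⟨_, G₀, hG₀, hcard₀, rfl⟩, ⟨?_, fun h => hdisj s hs' (h hs)⟩, ?_⟩, ?_⟩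
  · exact hdisj _ (h (image_tag_mem_maxChainSet hspine hG₀ hcard₀)).2 ⟨G₀, hG₀, hcard₀, rfl⟩
  · rintro F hF hFX G ⟨hG, c, hc, ⟨u, hu, huc⟩, ⟨v, hv, hvc⟩⟩ hedge
    obtain rfl : u = lowerCopy c hc := Subtype.ext huc
    obtain rfl : v = upperCopy c hc := Subtype.ext hvc
    have hno : ¬ ∃ z, ∃ hz : z ∈ C, lowerCopy z hz ∈ F ∧ upperCopy z hz ∈ F :=
      fun ⟨z, hz, h0, h1⟩ => hFX ⟨hF, z, hz, ⟨_, h0, rfl⟩, ⟨_, h1, rfl⟩⟩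
    obtain ⟨x, -, hxF, hsub⟩ := hedge.exists_notMem ⟨_, hu⟩
    by_cases hx : x = lowerCopy c hc
    · subst hx
      exact hno (exists_copies_mem_of_lowerCopy_notMem hF hG hc hu
        (hsub _ hv (lowerCopy_ne_upperCopy hc hc).symm) hxF hsub)
    · have hlowF := hsub _ hu (Ne.symm hx)
      obtain rfl : upperCopy c hc = x := by
        by_contra hne
        exact hno ⟨c, hc, hlowF, hsub _ hv hne⟩
      exact hno (exists_copies_mem_of_upperCopy_notMem hconv hF hG hc hv hlowF hxF hsub)
  · rintro _ ⟨G, hG, hcard, rfl⟩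
    exact image_tag_mem_maxChainSet hspine hG hcard
  · rintro F hF hFX _ ⟨G, hG, hcard, rfl⟩ hedge
    exact hFX (exists_eq_image_tag_of_faEdge hspine hG hcard hF hedge)
  · exact Set.eq_empty_iff_forall_notMem.2 fun t ht => hdisj t ht.1.2 ht.2
end

section
/- Let G be a finite simple graph. There exists an orientation of the edges of G such that the resulting directed graph has no directed walk of length 3 (i.e., no vertices a, b, c, d with arrows a → b, b → c, c → d) if and only if the chromatic number of G is at most 3. -/
universe u

open Classical in
/-- If `r` has no walk of length three, the length of the longest `r`-walk leaving a vertex. -/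
noncomputable def walkHeight {V : Type u} (r : V → V → Prop) (x : V) : Fin 3 :=
  if ∃ b c, r x b ∧ r b c then 2 else if ∃ b, r x b then 1 else 0

theorem walkHeight_ne_of_rel {V : Type u} {r : V → V → Prop}
    (h : ¬ ∃ a b c d : V, r a b ∧ r b c ∧ r c d) {x y : V} (hxy : r x y) :
    walkHeight r x ≠ walkHeight r y := by
  have hy : ¬ ∃ b c, r y b ∧ r b c := fun ⟨b, c, hb, hc⟩ => h ⟨x, y, b, c, hxy, hb, hc⟩
  have hx : ∃ b, r x b := ⟨y, hxy⟩
  unfold walkHeight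
  by_cases hy' : ∃ b, r y b
  · have hx' : ∃ b c, r x b ∧ r b c := hy'.elim fun b hb => ⟨y, b, hxy, hb⟩
    rw [if_pos hx', if_neg hy, if_pos hy']
    decide
  · rw [if_neg hy, if_neg hy', if_pos hx]
    split_ifs <;> decide

/-- A finite simple graph admits an orientation of its edges with no directed walk of
length 3 if and only if its chromatic number is at most 3. -/
theorem orientation_no_walk_three_iff_chromatic_le_three (V : Type u) [Fintype V]
    (G : SimpleGraph V) :
    (∃ r : V → V → Prop,
      (∀ x y : V, r x y → G.Adj x y) ∧
      (∀ x y : V, G.Adj x y → (r x y ↔ ¬ r y x)) ∧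
      ¬ ∃ a b c d : V, r a b ∧ r b c ∧ r c d) ↔
    G.chromaticNumber ≤ 3 := by
  refine Iff.trans ?_ (SimpleGraph.chromaticNumber_le_iff_colorable (n := 3)).symm
  constructor
  · rintro ⟨r, -, hr, h⟩
    refine ⟨SimpleGraph.Coloring.mk (walkHeight r) fun {x y} hxy => ?_⟩
    by_cases hyx : r y x
    · exact (walkHeight_ne_of_rel h hyx).symm
    · exact walkHeight_ne_of_rel h ((hr x y hxy).2 hyx)
  · rintro ⟨C⟩
    refine ⟨fun x y => G.Adj x y ∧ C x < C y, fun x y h => h.1, fun x y hxy => ?_, ?_⟩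
    · have hC := C.valid hxy
      simp only [hxy, hxy.symm, true_and, not_lt]
      exact ⟨le_of_lt, fun hle => lt_of_le_of_ne hle hC⟩
    · rintro ⟨a, b, c, d, ⟨-, hab⟩, ⟨-, hbc⟩, ⟨-, hcd⟩⟩
      omega
end
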